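/- Let W be an n-dimensional vector space and 𝓘=(I^1,…,I^s) an s-tuple of subsets of [n], each of cardinality r, such that dim(Gr(r,n)) − Σ_{j=1}^{s} codim(ω_{I^j}) = 0. Then for a generic point 𝓔 ∈ Fl(W)^s, the scheme-theoretic intersection ∩_{j=1}^{s} Ω_{I^j}(E^j_•) is a reduced zero-dimensional scheme (possibly empty). This holds over an algebraically closed field of any characteristic. -/

import Mathlib

noncomputable section

open Module Submodule

/-! ### Polynomial functions and the Zariski topology on a vector space -/

/-- Evaluation of a polynomial in linear functionals at a point of a vector space.
These are exactly the polynomial functions on a finite-dimensional vector space. -/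
def mEval (k : Type*) {M : Type*} [Field k] [AddCommGroup M] [Module k M]
    (x : M) (p : MvPolynomial (Module.Dual k M) k) : k :=
  MvPolynomial.eval (fun l : Module.Dual k M => l x) p

/-- The Zariski topology on a (finite-dimensional) vector space, generated by the
complements of zero sets of polynomial functions. -/
def mZariski (k M : Type*) [Field k] [AddCommGroup M] [Module k M] :
    TopologicalSpace M :=
  TopologicalSpace.generateFrom
    {U : Set M | ∃ p : MvPolynomial (Module.Dual k M) k, U = {x : M | mEval k x p ≠ 0}}

/-- The Zariski tangent space at a point `x` to a subset `A` of a vector space: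
the common kernel of the differentials at `x` of all polynomial functions vanishing on `A`. -/
def mTangent (k : Type*) {M : Type*} [Field k] [AddCommGroup M] [Module k M]
    (A : Set M) (x : M) : Submodule k M :=
  letI := Classical.decEq (Module.Dual k M)
  ⨅ p ∈ {p : MvPolynomial (Module.Dual k M) k | ∀ a ∈ A, mEval k a p = 0},
    LinearMap.ker (∑ l ∈ p.vars, mEval k x (MvPolynomial.pderiv l p) • (l : Module.Dual k M))

/-- `f : M → N` is a polynomial map on a subset `A ⊆ M`. -/
def IsPolyOn (k : Type*) {M N : Type*} [Field k] [AddCommGroup M] [Module k M]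
    [AddCommGroup N] [Module k N] (A : Set M) (f : M → N) : Prop :=
  ∀ l : Module.Dual k N, ∃ p : MvPolynomial (Module.Dual k M) k, ∀ x ∈ A, l (f x) = mEval k x p

/-- Dimension (topological Krull dimension) of a subset of a topological space. -/
def subDim {α : Type*} (t : TopologicalSpace α) (C : Set α) : WithBot ℕ∞ :=
  @topologicalKrullDim C (TopologicalSpace.induced (Subtype.val : C → α) t)

/-- The irreducible components of a subset `A` of a topological space
(for the subspace topology). -/
def subComponents {α : Type*} (t : TopologicalSpace α) (A : Set α) : Set (Set ↥A) :=
  @irreducibleComponents A (TopologicalSpace.induced (Subtype.val : A → α) t)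

/-- Dimension of a subset `C` of a subspace `A` of a topological space. -/
def compDim {α : Type*} (t : TopologicalSpace α) (A : Set α) (C : Set ↥A) : WithBot ℕ∞ :=
  subDim (TopologicalSpace.induced (Subtype.val : A → α) t) C

/-! ### Flags, Schubert cells and Schubert varieties -/

/-- A complete flag on a finite-dimensional vector space, recorded as the increasing
function sending `m` to the `m`-th member (of dimension `m`) of the flag. -/
def IsFlag {k M : Type*} [Field k] [AddCommGroup M] [Module k M]
    (E : ℕ → Submodule k M) : Prop :=
  Monotone E ∧ ∀ m : ℕ, finrank k ↥(E m) = min m (finrank k M)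

/-- Membership of `V` in the (open) Schubert cell `Ω°_I(E_•) ⊆ Gr(r, M)` attached to the
subset `I ⊆ [n]` recorded by the strictly increasing tuple `i : Fin r → Fin n`
(`0`-indexed: the `1`-based subset is `{i a + 1}`): `dim (V ∩ E_u) = #{a | i_a ≤ u}`. -/
def cellMem {k M : Type*} [Field k] [AddCommGroup M] [Module k M] {n r : ℕ}
    (i : Fin r → Fin n) (E : ℕ → Submodule k M) (V : Submodule k M) : Prop :=
  finrank k ↥V = r ∧
    ∀ u : ℕ, u ≤ n →
      finrank k ↥(V ⊓ E u) =
        (Finset.univ.filter (fun a : Fin r => (i a : ℕ) + 1 ≤ u)).card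

/-- Membership of `V` in the (closed) Schubert variety `Ω_I(E_•) ⊆ Gr(r, M)`:
`dim (V ∩ E_{i_a}) ≥ a` for `a = 1, …, r`. -/
def varMem {k M : Type*} [Field k] [AddCommGroup M] [Module k M] {n r : ℕ}
    (i : Fin r → Fin n) (E : ℕ → Submodule k M) (V : Submodule k M) : Prop :=
  finrank k ↥V = r ∧ ∀ a : Fin r, (a : ℕ) + 1 ≤ finrank k ↥(V ⊓ E ((i a : ℕ) + 1))

/-- The flag induced on a subspace `V` by a flag `E` on `M`: its `a`-th member is the
smallest subspace of the form `V ∩ E_u` of dimension `≥ a`. -/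
def indSub {k M : Type*} [Field k] [AddCommGroup M] [Module k M]
    (E : ℕ → Submodule k M) (V : Submodule k M) : ℕ → Submodule k ↥V := fun a =>
  ⨅ u ∈ {u : ℕ | a ≤ finrank k ↥(Submodule.comap V.subtype (E u))},
    Submodule.comap V.subtype (E u)

/-- The flag induced on the quotient `M ⧸ V` by a flag `E` on `M`: its `b`-th member is
the smallest subspace of the form `(E_u + V)/V` of dimension `≥ b`. -/
def indQuot {k M : Type*} [Field k] [AddCommGroup M] [Module k M]
    (E : ℕ → Submodule k M) (V : Submodule k M) : ℕ → Submodule k (M ⧸ V) := fun b =>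
  ⨅ u ∈ {u : ℕ | b ≤ finrank k ↥(Submodule.map V.mkQ (E u))},
    Submodule.map V.mkQ (E u)

/-- The flag spanned by a tuple of vectors (a complete flag when the tuple is a basis). -/
def spanFlag (k : Type*) {M : Type*} [Field k] [AddCommGroup M] [Module k M] {r : ℕ}
    (b : Fin r → M) : ℕ → Submodule k M := fun m =>
  Submodule.span k (b '' {a : Fin r | (a : ℕ) < m})

/-- `P` holds for a generic point of `Fl(M)^s` (`r = dim M`): there is a nonempty Zariski
open set of `s`-tuples of bases of `M` on which the associated tuples of complete flags
satisfy `P`. -/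
def GenericFlags (k : Type*) {M : Type*} [Field k] [AddCommGroup M] [Module k M]
    (s r : ℕ) (P : (Fin s → ℕ → Submodule k M) → Prop) : Prop :=
  ∃ U : Set (Fin s → Fin r → M),
    @IsOpen _ (mZariski k (Fin s → Fin r → M)) U ∧
    (∃ b ∈ U, ∀ j, LinearIndependent k (b j)) ∧
    ∀ b ∈ U, (∀ j, LinearIndependent k (b j)) → P (fun j => spanFlag k (b j))

/-- `P` holds for a generic point of `Fl(M)^s × Fl(Q)^s` (`r = dim M`, `q = dim Q`). -/
def GenericFlagPairs (k : Type*) {M Q : Type*} [Field k] [AddCommGroup M] [Module k M]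
    [AddCommGroup Q] [Module k Q] (s r q : ℕ)
    (P : (Fin s → ℕ → Submodule k M) → (Fin s → ℕ → Submodule k Q) → Prop) : Prop :=
  ∃ U : Set ((Fin s → Fin r → M) × (Fin s → Fin q → Q)),
    @IsOpen _ (mZariski k ((Fin s → Fin r → M) × (Fin s → Fin q → Q))) U ∧
    (∃ b ∈ U, (∀ j, LinearIndependent k (b.1 j)) ∧ ∀ j, LinearIndependent k (b.2 j)) ∧
    ∀ b ∈ U, ((∀ j, LinearIndependent k (b.1 j)) ∧ ∀ j, LinearIndependent k (b.2 j)) →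
      P (fun j => spanFlag k (b.1 j)) (fun j => spanFlag k (b.2 j))

/-! ### The spaces `Hom_𝓘(V, Q, 𝓕, 𝓖)` -/

/-- The subspace `{φ : M →ₗ Q | φ(p) ⊆ q}` of `Hom(M, Q)`. -/
def homConstraint {k M Q : Type*} [Field k] [AddCommGroup M] [Module k M]
    [AddCommGroup Q] [Module k Q] (p : Submodule k M) (q : Submodule k Q) :
    Submodule k (M →ₗ[k] Q) :=
  LinearMap.ker ((LinearMap.llcomp k ↥p Q (Q ⧸ q) q.mkQ).comp (LinearMap.lcomp k Q p.subtype))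

/-- `Hom_𝓘(M, Q, F, G) = {φ | φ(F^j_a) ⊆ G^j_{i^j_a - a} for all a = 1, …, r, j = 1, …, s}`. -/
def homSpace {k M Q : Type*} [Field k] [AddCommGroup M] [Module k M]
    [AddCommGroup Q] [Module k Q] {n r s : ℕ} (I : Fin s → Fin r → Fin n)
    (F : Fin s → ℕ → Submodule k M) (G : Fin s → ℕ → Submodule k Q) :
    Submodule k (M →ₗ[k] Q) :=
  ⨅ j : Fin s, ⨅ a : Fin r,
    homConstraint (F j ((a : ℕ) + 1)) (G j ((I j a : ℕ) - (a : ℕ)))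

/-! ### Charts on the Grassmannian, tangent spaces to Schubert cells -/

/-- The graph of `ψ : V →ₗ C`, a point of the Grassmannian chart around `V`
determined by a complement `C` of `V`. -/
def graphMap {k M : Type*} [Field k] [AddCommGroup M] [Module k M]
    (V C : Submodule k M) (ψ : ↥V →ₗ[k] ↥C) : Submodule k M :=
  LinearMap.range (V.subtype + C.subtype ∘ₗ ψ)

/-- The canonical identification `Hom(V, C) ≃ Hom(V, M/V)` (derivative of the chart). -/
def conjMap {k M : Type*} [Field k] [AddCommGroup M] [Module k M]
    (V C : Submodule k M) : (↥V →ₗ[k] ↥C) →ₗ[k] (↥V →ₗ[k] M ⧸ V) :=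
  LinearMap.llcomp k ↥V ↥C (M ⧸ V) (V.mkQ ∘ₗ C.subtype)

/-- The tangent space at `V` to a set `S` of points of the Grassmannian `Gr(r, M)`,
computed in the chart determined by a complement `C` of `V` and viewed inside
`Hom(V, M/V)` via the canonical identification. -/
def grTangent {k M : Type*} [Field k] [AddCommGroup M] [Module k M]
    (S : Set (Submodule k M)) (V C : Submodule k M) :
    Submodule k (↥V →ₗ[k] (M ⧸ V)) :=
  Submodule.map (conjMap V C)
    (mTangent k {ψ : ↥V →ₗ[k] ↥C | graphMap V C ψ ∈ S} 0)

/-- The Zariski topology on the Grassmannian of `r`-dimensional subspaces of `M`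
(as a topology on `Submodule k M`), coinduced from the Stiefel parameterization by
spanning `r`-tuples. -/
def grTop (k : Type*) {M : Type*} [Field k] [AddCommGroup M] [Module k M] (r : ℕ) :
    TopologicalSpace (Submodule k M) :=
  TopologicalSpace.coinduced (fun b : Fin r → M => Submodule.span k (Set.range b))
    (mZariski k (Fin r → M))

/-! ### Numerical quantities -/

/-- `codim ω_I = ∑_{a=1}^r (n - r + a - i_a)` (as an integer). -/
def codimZ (n r : ℕ) (i : Fin r → Fin n) : ℤ :=
  ∑ a : Fin r, ((n : ℤ) - (r : ℤ) + ((a : ℕ) : ℤ) - ((i a : ℕ) : ℤ))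

/-- The quantity `∑_j ∑_{a ∈ K^j} (n - r + a - i^j_a) - d(n - r)` of Inequality `(†^𝓘_𝓚)`. -/
def daggerZ (n r d : ℕ) {s : ℕ} (I : Fin s → Fin r → Fin n)
    (K : Fin s → Fin d → Fin r) : ℤ :=
  (∑ j : Fin s, ∑ t : Fin d,
      ((n : ℤ) - (r : ℤ) + ((K j t : ℕ) : ℤ) - ((I j (K j t) : ℕ) : ℤ)))
    - (d : ℤ) * ((n : ℤ) - (r : ℤ))

/-- The expected dimension `dim(S, M, 𝓕) = d(m - d) - ∑_j ∑_{t=1}^d (m - d + t - k^j_t)`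
of an intersection of Schubert cells `Ω°_{K^j}` in `Gr(d, m)`. -/
def eDimZ {s : ℕ} (m d : ℕ) (K : Fin s → Fin d → Fin m) : ℤ :=
  (d : ℤ) * ((m : ℤ) - (d : ℤ)) -
    ∑ j : Fin s, ∑ t : Fin d,
      ((m : ℤ) - (d : ℤ) + ((t : ℕ) : ℤ) - ((K j t : ℕ) : ℤ))

/-- `codim ω_I` as a natural number. -/
def codimN (n r : ℕ) (i : Fin r → Fin n) : ℕ :=
  ∑ a : Fin r, ((n - r + (a : ℕ)) - (i a : ℕ))

/-! ### The cohomology ring of the Grassmannian, Schubert classes -/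

/-- The ideal `(h_{n-r+1}, …, h_n)` of the polynomial ring in `r` variables
(`h_m` the complete homogeneous symmetric polynomials). -/
def grassIdeal (r n : ℕ) : Ideal (MvPolynomial (Fin r) ℤ) :=
  Ideal.span ((fun m : ℕ => MvPolynomial.hsymm (Fin r) ℤ m) '' Set.Icc (n - r + 1) n)

/-- A presentation of the cohomology (Chow) ring `H^*(Gr(r,n))`: products of Schubert
classes vanish here exactly when they vanish in `H^*(Gr(r,n))`. -/
abbrev grassRing (r n : ℕ) : Type :=
  MvPolynomial (Fin r) ℤ ⧸ grassIdeal r n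

/-- `h_m` for an integer `m` (zero for negative `m`). -/
def hkZ (r : ℕ) (m : ℤ) : MvPolynomial (Fin r) ℤ :=
  if 0 ≤ m then MvPolynomial.hsymm (Fin r) ℤ m.toNat else 0

/-- The Schur polynomial (Jacobi–Trudi determinant) of the partition
`λ_a = n - r + a - i_a` attached to the subset `I ⊆ [n]` recorded by `i`. -/
def schurI {n r : ℕ} (i : Fin r → Fin n) : MvPolynomial (Fin r) ℤ :=
  Matrix.det (Matrix.of fun a b : Fin r =>
    hkZ r ((n : ℤ) - (r : ℤ) + ((b : ℕ) : ℤ) - ((i a : ℕ) : ℤ)))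

/-- The Schubert class `ω_I ∈ H^*(Gr(r,n))` of the subset `I ⊆ [n]` recorded by the
strictly increasing tuple `i : Fin r → Fin n`. -/
def omegaCls {n r : ℕ} (i : Fin r → Fin n) : grassRing r n :=
  Ideal.Quotient.mk (grassIdeal r n) (schurI i)

/-- The class of a point in `H^*(Gr(r,n))`: the Schubert class of `I = {1, …, r}`. -/
def pointCls (r n : ℕ) (h : r ≤ n) : grassRing r n :=
  omegaCls (fun a : Fin r => Fin.castLE h a)

/-! ### Schur polynomials of partitions, Littlewood–Richardson coefficients -/

/-- The Schur polynomial of a partition with at most `r` parts, via Jacobi–Trudi. -/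
def schurP {r : ℕ} (lam : Fin r → ℕ) : MvPolynomial (Fin r) ℤ :=
  Matrix.det (Matrix.of fun a b : Fin r =>
    hkZ r (((lam a : ℕ) : ℤ) - ((a : ℕ) : ℤ) + ((b : ℕ) : ℤ)))

/-- The Vandermonde alternant `a_δ = det(x_a^{r-1-b})`. -/
def alternant (r : ℕ) : MvPolynomial (Fin r) ℤ :=
  Matrix.det (Matrix.of fun a b : Fin r => (MvPolynomial.X a) ^ (r - 1 - (b : ℕ)))

/-- The coefficient of the Schur polynomial `s_δ` in a symmetric polynomial `f`
(in `r` variables): the coefficient of the monomial `x^{δ + (r-1, …, 1, 0)}` in `f ⬝ a_δ`. -/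
def schurCoeff (r : ℕ) (f : MvPolynomial (Fin r) ℤ) (δ : Fin r → ℕ) : ℤ :=
  MvPolynomial.coeff
    (Finsupp.equivFunOnFinite.symm (fun a : Fin r => δ a + (r - 1 - (a : ℕ))))
    (f * alternant r)

/-- The Littlewood–Richardson coefficient `c^λ_{μ,ν}` (partitions with at most `r` parts):
the multiplicity of `V_λ` in `V_μ ⊗ V_ν`, i.e. of `s_λ` in `s_μ s_ν`. -/
def lrCoeff (r : ℕ) (lam mu nu : Fin r → ℕ) : ℤ :=
  schurCoeff r (schurP mu * schurP nu) lam

/-- The multiplicity of `V_δ` in `V_{Λ 1} ⊗ ⋯ ⊗ V_{Λ t}` (as `GL(r)`-representations),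
i.e. of `s_δ` in `∏_j s_{Λ j}`. -/
def multiCoeff (r : ℕ) {t : ℕ} (Λ : Fin t → Fin r → ℕ) (δ : Fin r → ℕ) : ℤ :=
  schurCoeff r (∏ j : Fin t, schurP (Λ j)) δ

/-! ### Polynomial maps between vector spaces -/

/-- The algebra of polynomial functions on a vector space. -/
def PolyFn (k M : Type*) [Field k] [AddCommGroup M] [Module k M] : Subalgebra k (M → k) :=
  Algebra.adjoin k (Set.range fun l : Dual k M => (l : M → k))

/-- A map of vector spaces is polynomial if its composition with every linear functional is a
polynomial function. -/
@[fun_prop]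
def PolyMap (k : Type*) {M N : Type*} [Field k] [AddCommGroup M] [Module k M]
    [AddCommGroup N] [Module k N] (g : M → N) : Prop :=
  ∀ l : Dual k N, (fun x => l (g x)) ∈ PolyFn k M

namespace PolyMap

variable {k M N N₁ N₂ : Type*} [Field k] [AddCommGroup M] [Module k M]
  [AddCommGroup N] [Module k N] [AddCommGroup N₁] [Module k N₁] [AddCommGroup N₂] [Module k N₂]

theorem iff_mem {f : M → k} : PolyMap k f ↔ f ∈ PolyFn k M := by
  refine ⟨fun h => h LinearMap.id, fun h l => ?_⟩
  have : (fun x => l (f x)) = l 1 • f := by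
    ext x
    have := l.map_smul (f x) 1
    simp only [smul_eq_mul, mul_one] at this
    simp [this, mul_comm]
  rw [this]
  exact Subalgebra.smul_mem _ h _

theorem _root_.LinearMap.polyMap (g : M →ₗ[k] N) : PolyMap k g := fun l =>
  Algebra.subset_adjoin ⟨l ∘ₗ g, rfl⟩

@[fun_prop]
theorem id' : PolyMap k (fun x : M => x) := LinearMap.id.polyMap

@[fun_prop]
theorem const (y : N) : PolyMap k (fun _ : M => y) := fun l =>
  (PolyFn k M).algebraMap_mem (l y)

@[fun_prop]
theorem comp {g : N → N₁} {f : M → N} (hg : PolyMap k g) (hf : PolyMap k f) :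
    PolyMap k (fun x => g (f x)) := by
  intro l
  have key : ∀ u ∈ PolyFn k N, (fun x => u (f x)) ∈ PolyFn k M := by
    intro u hu
    induction hu using Algebra.adjoin_induction with
    | mem u hu => obtain ⟨l, rfl⟩ := hu; exact hf l
    | algebraMap r => exact (PolyFn k M).algebraMap_mem r
    | add u v _ _ hu hv => exact (PolyFn k M).add_mem hu hv
    | mul u v _ _ hu hv => exact (PolyFn k M).mul_mem hu hv
  exact key _ (hg l)

@[fun_prop]
theorem linear_comp (g : N →ₗ[k] N₁) {f : M → N} (hf : PolyMap k f) :
    PolyMap k (fun x => g (f x)) := g.polyMap.comp hf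

@[fun_prop]
theorem add {f g : M → N} (hf : PolyMap k f) (hg : PolyMap k g) :
    PolyMap k (fun x => f x + g x) := fun l => by
  simp only [map_add]
  exact (PolyFn k M).add_mem (hf l) (hg l)

@[fun_prop]
theorem sub {f g : M → N} (hf : PolyMap k f) (hg : PolyMap k g) :
    PolyMap k (fun x => f x - g x) := fun l => by
  simp only [map_sub]
  exact (PolyFn k M).sub_mem (hf l) (hg l)

@[fun_prop]
theorem smul {c : M → k} {f : M → N} (hc : PolyMap k c) (hf : PolyMap k f) :
    PolyMap k (fun x => c x • f x) := fun l => by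
  simp only [map_smul, smul_eq_mul]
  exact (PolyFn k M).mul_mem (iff_mem.1 hc) (hf l)

@[fun_prop]
theorem mul {f g : M → k} (hf : PolyMap k f) (hg : PolyMap k g) :
    PolyMap k (fun x => f x * g x) := hf.smul hg

@[fun_prop]
theorem sum {ι : Type*} (s : Finset ι) {f : ι → M → N} (hf : ∀ i, PolyMap k (f i)) :
    PolyMap k (fun x => ∑ i ∈ s, f i x) := fun l => by
  have := (PolyFn k M).sum_mem (t := s) (fun i _ => hf i l)
  convert this
  simp

@[fun_prop]
theorem prod {ι : Type*} (s : Finset ι) {f : ι → M → k} (hf : ∀ i, PolyMap k (f i)) :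
    PolyMap k (fun x => ∏ i ∈ s, f i x) := by
  rw [iff_mem]
  have := (PolyFn k M).prod_mem (t := s) (fun i _ => iff_mem.1 (hf i))
  convert this
  simp

@[fun_prop]
theorem fst {f : M → N × N₁} (hf : PolyMap k f) : PolyMap k (fun x => (f x).1) :=
  linear_comp (LinearMap.fst k N N₁) hf

@[fun_prop]
theorem snd {f : M → N × N₁} (hf : PolyMap k f) : PolyMap k (fun x => (f x).2) :=
  linear_comp (LinearMap.snd k N N₁) hf

@[fun_prop]
theorem prodMk {f : M → N} {g : M → N₁} (hf : PolyMap k f) (hg : PolyMap k g) :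
    PolyMap k (fun x => (f x, g x)) := by
  have : (fun x => (f x, g x)) = fun x =>
      LinearMap.inl k N N₁ (f x) + LinearMap.inr k N N₁ (g x) := by ext x <;> simp
  rw [this]
  fun_prop

@[fun_prop]
theorem apply {ι : Type*} {X : ι → Type*} [∀ i, AddCommGroup (X i)] [∀ i, Module k (X i)] (i : ι) :
    PolyMap k (fun x : ∀ i, X i => x i) :=
  (LinearMap.proj (R := k) (φ := X) i).polyMap

@[fun_prop]
theorem pi {ι : Type*} [Finite ι] {X : ι → Type*} [∀ i, AddCommGroup (X i)]
    [∀ i, Module k (X i)] {f : M → ∀ i, X i} (hf : ∀ i, PolyMap k (fun x => f x i)) :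
    PolyMap k (fun x => f x) := by
  classical
  have := Fintype.ofFinite ι
  have : f = fun x => ∑ i, LinearMap.single k X i (f x i) := by
    ext x j
    simp [Finset.sum_apply]
  rw [this]
  exact sum _ fun i => linear_comp _ (hf i)

theorem bilin [FiniteDimensional k N] (B : N →ₗ[k] N₁ →ₗ[k] N₂) {f : M → N} {g : M → N₁}
    (hf : PolyMap k f) (hg : PolyMap k g) : PolyMap k (fun x => B (f x) (g x)) := by
  let b := finBasis k N
  have : (fun x => B (f x) (g x)) = fun x => ∑ i, b.coord i (f x) • B (b i) (g x) := by
    ext x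
    conv_lhs => rw [← b.sum_repr (f x)]
    simp only [map_sum, map_smul, LinearMap.sum_apply, LinearMap.smul_apply, Basis.coord_apply]
  rw [this]
  fun_prop

@[fun_prop]
theorem det {ι : Type*} [Fintype ι] [DecidableEq ι] {A : M → Matrix ι ι k}
    (hA : ∀ i j, PolyMap k (fun x => A x i j)) : PolyMap k (fun x => (A x).det) := by
  simp only [Matrix.det_apply']
  fun_prop

theorem line {f : M → k} (hf : PolyMap k f) (x y : M) :
    ∃ P : Polynomial k, ∀ t, P.eval t = f (x + t • y) := by
  rw [iff_mem] at hf
  induction hf using Algebra.adjoin_induction with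
  | mem u hu =>
    obtain ⟨l, rfl⟩ := hu
    exact ⟨Polynomial.C (l x) + Polynomial.X * Polynomial.C (l y), fun t => by simp; ring⟩
  | algebraMap r => exact ⟨Polynomial.C r, fun t => by simp⟩
  | add u v _ _ hu hv =>
    obtain ⟨P, hP⟩ := hu; obtain ⟨Q, hQ⟩ := hv
    exact ⟨P + Q, fun t => by simp [hP, hQ]⟩
  | mul u v _ _ hu hv =>
    obtain ⟨P, hP⟩ := hu; obtain ⟨Q, hQ⟩ := hv
    exact ⟨P * Q, fun t => by simp [hP, hQ]⟩

theorem exists_mul_ne_zero [Infinite k] {f g : M → k} (hf : PolyMap k f) (hg : PolyMap k g)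
    {x y : M} (hx : f x ≠ 0) (hy : g y ≠ 0) : ∃ z, f z * g z ≠ 0 := by
  obtain ⟨P, hP⟩ := hf.line x (y - x)
  obtain ⟨Q, hQ⟩ := hg.line x (y - x)
  have hP0 : P ≠ 0 := by rintro rfl; exact hx (by simpa using (hP 0).symm)
  have hQ0 : Q ≠ 0 := by rintro rfl; exact hy (by simpa using (hQ 1).symm)
  obtain ⟨t, ht⟩ : ∃ t, (P * Q).eval t ≠ 0 := by
    by_contra! h
    exact mul_ne_zero hP0 hQ0 (Polynomial.funext fun t => by simpa using h t)
  exact ⟨x + t • (y - x), by rw [← hP, ← hQ]; simpa using ht⟩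

end PolyMap

/-! ### The generic filter of the Zariski topology -/

/-- The filter of subsets of a vector space containing a nonempty principal Zariski open set. -/
def zar (k M : Type*) [Field k] [Infinite k] [AddCommGroup M] [Module k M] : Filter M where
  sets := {S | ∃ f : M → k, PolyMap k f ∧ (∃ x, f x ≠ 0) ∧ ∀ x, f x ≠ 0 → x ∈ S}
  univ_sets := ⟨fun _ => 1, by fun_prop, ⟨0, one_ne_zero⟩, fun _ _ => trivial⟩
  sets_of_superset := by
    rintro S T ⟨f, hf, hx, h⟩ hST
    exact ⟨f, hf, hx, fun x hx => hST (h x hx)⟩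
  inter_sets := by
    rintro S T ⟨f, hf, ⟨x, hx⟩, h⟩ ⟨g, hg, ⟨y, hy⟩, h'⟩
    exact ⟨fun x => f x * g x, by fun_prop, hf.exists_mul_ne_zero hg hx hy,
      fun x hx => ⟨h x (left_ne_zero_of_mul hx), h' x (right_ne_zero_of_mul hx)⟩⟩

section zar

variable {k M N X Y : Type*} [Field k] [Infinite k] [AddCommGroup M] [Module k M]
  [AddCommGroup N] [Module k N] [AddCommGroup X] [Module k X] [AddCommGroup Y] [Module k Y]

theorem eventually_zar {P : M → Prop} : (∀ᶠ x in zar k M, P x) ↔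
    ∃ f : M → k, PolyMap k f ∧ (∃ x, f x ≠ 0) ∧ ∀ x, f x ≠ 0 → P x := Iff.rfl

instance : (zar k M).NeBot := by
  refine Filter.neBot_iff.2 fun h => ?_
  have : ∀ᶠ x in zar k M, False := by rw [h]; trivial
  obtain ⟨f, -, ⟨x, hx⟩, h⟩ := eventually_zar.1 this
  exact h x hx

theorem frequently_zar {P : M → Prop} : (∃ᶠ x in zar k M, P x) ↔
    ∀ f : M → k, PolyMap k f → (∃ x, f x ≠ 0) → ∃ x, f x ≠ 0 ∧ P x := by
  rw [Filter.Frequently, eventually_zar]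
  push Not
  rfl

theorem PolyMap.eventually_ne {f : M → k} (hf : PolyMap k f) {x : M} (hx : f x ≠ 0) :
    ∀ᶠ x in zar k M, f x ≠ 0 := eventually_zar.2 ⟨f, hf, ⟨x, hx⟩, fun _ h => h⟩

theorem PolyMap.tendsto_zar {g : M → N} (hg : PolyMap k g) (hs : Function.Surjective g) :
    Filter.Tendsto g (zar k M) (zar k N) := by
  rintro S ⟨f, hf, ⟨y, hy⟩, h⟩
  obtain ⟨x, rfl⟩ := hs y
  exact ⟨fun x => f (g x), by fun_prop, ⟨x, hy⟩, fun x hx => h _ hx⟩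

theorem tendsto_zar_linearEquiv (e : M ≃ₗ[k] N) : Filter.Tendsto e (zar k M) (zar k N) :=
  e.toLinearMap.polyMap.tendsto_zar e.surjective

theorem eventually_linearIndependent [FiniteDimensional k Y] {ι : Type*} [Finite ι]
    {v : M → ι → Y} (hv : ∀ i, PolyMap k (fun x => v x i)) {x₀ : M}
    (h₀ : LinearIndependent k (v x₀)) : ∀ᶠ x in zar k M, LinearIndependent k (v x) := by
  classical
  have := Fintype.ofFinite ι
  obtain ⟨g, hg⟩ := (Fintype.linearCombination k (v x₀)).exists_leftInverse_of_injective
    (LinearMap.ker_eq_bot.2 (linearIndependent_iff_injective_fintypeLinearCombination.1 h₀))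
  have hpoly : PolyMap k fun x => (Matrix.of fun i j => g (v x i) j).det :=
    PolyMap.det fun i j => by
      have := hv i
      simp only [Matrix.of_apply]
      exact (PolyMap.apply j).comp (PolyMap.linear_comp g this)
  have h1 : (Matrix.of fun i j => g (v x₀ i) j) = 1 := by
    ext i j
    have := congrFun (LinearMap.congr_fun hg (Pi.single i 1)) j
    simp [Fintype.linearCombination_apply, Pi.single_apply] at this
    simp [this, Matrix.one_apply, eq_comm]
  filter_upwards [hpoly.eventually_ne (x := x₀) (by rw [h1]; simp)] with x hx
  have := Matrix.linearIndependent_rows_of_det_ne_zero hx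
  exact LinearIndependent.of_comp g this

theorem eventually_surjective [FiniteDimensional k Y] {L : M → (X →ₗ[k] Y)}
    (hL : ∀ u, PolyMap k (fun x => L x u)) {x₀ : M} (h₀ : Function.Surjective (L x₀)) :
    ∀ᶠ x in zar k M, Function.Surjective (L x) := by
  let b := finBasis k Y
  choose u hu using fun i => h₀ (b i)
  have h := eventually_linearIndependent (k := k) (v := fun x i => L x (u i)) (x₀ := x₀)
    (fun i => hL (u i)) (by simpa only [hu] using b.linearIndependent)
  filter_upwards [h] with x hx
  rw [← LinearMap.range_eq_top, eq_top_iff, ← hx.span_eq_top_of_card_eq_finrank' (by simp)]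
  exact span_le.2 (by rintro _ ⟨i, rfl⟩; exact ⟨_, rfl⟩)

theorem eventually_injective [FiniteDimensional k X] [FiniteDimensional k Y] {L : M → (X →ₗ[k] Y)}
    (hL : ∀ u, PolyMap k (fun x => L x u)) {x₀ : M} (h₀ : Function.Injective (L x₀)) :
    ∀ᶠ x in zar k M, Function.Injective (L x) := by
  let b := finBasis k X
  have h := eventually_linearIndependent (k := k) (v := fun x i => L x (b i)) (x₀ := x₀)
    (fun i => hL (b i)) (b.linearIndependent.map' _ (LinearMap.ker_eq_bot.2 h₀))
  filter_upwards [h] with x hx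
  refine LinearMap.ker_eq_bot.1 (LinearMap.ker_eq_bot'.2 fun u hu => ?_)
  rw [← b.sum_repr u] at hu ⊢
  simp only [map_sum, map_smul] at hu
  simp [Fintype.linearIndependent_iff.1 hx _ hu]

end zar

/-! ### Transcendence degree of the algebra of polynomial functions -/

section trdeg

variable {k M N : Type*} [Field k] [AddCommGroup M] [Module k M]
  [AddCommGroup N] [Module k N] 

theorem MvPolynomial.polyMap_eval {ι : Type*} [Finite ι] {Φ : M → ι → k}
    (hΦ : ∀ i, PolyMap k fun x => Φ x i) (p : MvPolynomial ι k) :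
    PolyMap k fun x => MvPolynomial.eval (Φ x) p := by
  induction p using MvPolynomial.induction_on with
  | C a => simpa using PolyMap.const a
  | add p q hp hq => simpa using hp.add hq
  | mul_X p i hp => simpa using hp.mul (hΦ i)

theorem PolyMap.exists_eval {ι : Type*} [Finite ι] (b : Basis ι k M) {f : M → k}
    (hf : PolyMap k f) : ∃ p : MvPolynomial ι k, ∀ x, f x = MvPolynomial.eval (b.repr x) p := by
  classical
  have := Fintype.ofFinite ι
  rw [PolyMap.iff_mem] at hf
  induction hf using Algebra.adjoin_induction with
  | mem u hu =>
    obtain ⟨l, rfl⟩ := hu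
    refine ⟨∑ i, MvPolynomial.C (l (b i)) * MvPolynomial.X i, fun x => ?_⟩
    conv_lhs => rw [← b.sum_repr x]
    simp [-Basis.sum_repr, mul_comm]
  | algebraMap r => exact ⟨MvPolynomial.C r, fun t => by simp⟩
  | add u v _ _ hu hv =>
    obtain ⟨P, hP⟩ := hu; obtain ⟨Q, hQ⟩ := hv
    exact ⟨P + Q, fun t => by simp [hP, hQ]⟩
  | mul u v _ _ hu hv =>
    obtain ⟨P, hP⟩ := hu; obtain ⟨Q, hQ⟩ := hv
    exact ⟨P * Q, fun t => by simp [hP, hQ]⟩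

theorem aeval_polyFn_apply {ι : Type*} (y : ι → PolyFn k M) (p : MvPolynomial ι k) (x : M) :
    (MvPolynomial.aeval y p : PolyFn k M).1 x = MvPolynomial.eval (fun i => (y i).1 x) p := by
  have := MvPolynomial.comp_aeval_apply (R := k) y
    ((Pi.evalAlgHom k (fun _ : M => k) x).comp (PolyFn k M).val) p
  simp only [MvPolynomial.aeval_eq_eval] at this
  exact this

/-- The coordinate ring of a finite-dimensional vector space is a polynomial ring. -/
def polyFnEquiv [Infinite k] {ι : Type*} [Finite ι] (b : Basis ι k M) :
    MvPolynomial ι k ≃ₐ[k] PolyFn k M :=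
  AlgEquiv.ofBijective
    (MvPolynomial.aeval fun i => (⟨fun x => b.coord i x,
      PolyMap.iff_mem.1 (b.coord i).polyMap⟩ : PolyFn k M)) (by
    have key := aeval_polyFn_apply fun i => (⟨fun x => b.coord i x,
      PolyMap.iff_mem.1 (b.coord i).polyMap⟩ : PolyFn k M)
    constructor
    · intro p q h
      refine MvPolynomial.funext fun v => ?_
      obtain ⟨x, hx⟩ : ∃ x, (b.repr x : ι → k) = v :=
        ⟨b.equivFun.symm v, by rw [← b.equivFun_apply]; simp⟩
      rw [← hx]
      exact (key p x).symm.trans (Eq.trans (congrFun (congrArg Subtype.val h) x) (key q x))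
    · intro f
      obtain ⟨p, hp⟩ := (PolyMap.iff_mem.2 f.2).exists_eval b
      exact ⟨p, Subtype.ext (funext fun x => by rw [key, hp]; rfl)⟩)

theorem polyFnEquiv_X [Infinite k] {ι : Type*} [Finite ι] (b : Basis ι k M) (i : ι) :
    polyFnEquiv b (MvPolynomial.X i) =
      ⟨fun x => b.coord i x, PolyMap.iff_mem.1 (b.coord i).polyMap⟩ := MvPolynomial.aeval_X _ _

instance [Infinite k] [FiniteDimensional k M] : IsDomain (PolyFn k M) :=
  (polyFnEquiv (finBasis k M)).symm.toMulEquiv.isDomain _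

theorem trdeg_polyFn [Infinite k] [FiniteDimensional k M] :
    Algebra.trdeg k (PolyFn k M) = finrank k M := by
  have h := (IsTranscendenceBasis.mvPolynomial (Fin (finrank k M)) k)
  have := ((polyFnEquiv (finBasis k M)).isTranscendenceBasis h).lift_cardinalMk_eq_trdeg
  simpa using this.symm

/-- The coordinates of a polynomial map, as elements of the coordinate ring. -/
def PolyMap.coords {ι : Type*} (b : Basis ι k N) {Φ : M → N} (hΦ : PolyMap k Φ) (i : ι) :
    PolyFn k M := ⟨fun x => b.coord i (Φ x), hΦ _⟩

theorem PolyMap.algebraicIndependent_coords [Infinite k] {ι : Type*} [Finite ι]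
    (b : Basis ι k N) {Φ : M → N} (hΦ : PolyMap k Φ) :
    AlgebraicIndependent k (hΦ.coords b) ↔
      ∀ g : N → k, PolyMap k g → (∃ y, g y ≠ 0) → ∃ x, g (Φ x) ≠ 0 := by
  have key : ∀ p x, (MvPolynomial.aeval (hΦ.coords b) p : PolyFn k M).1 x =
      MvPolynomial.eval (b.repr (Φ x)) p := fun p x => aeval_polyFn_apply _ p x
  rw [algebraicIndependent_iff]
  constructor
  · rintro h g hg ⟨y, hy⟩
    obtain ⟨p, hp⟩ := hg.exists_eval b
    by_contra! h0
    have : p = 0 := h p (Subtype.ext (funext fun x => by rw [key, ← hp, h0]; rfl))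
    exact hy (by rw [hp, this, map_zero])
  · intro h p hp
    by_contra hp0
    obtain ⟨v, hv⟩ : ∃ v, MvPolynomial.eval v p ≠ 0 := by
      by_contra! h0
      exact hp0 (MvPolynomial.funext fun v => by simp [h0 v])
    have hpoly : PolyMap k fun y : N => MvPolynomial.eval (b.repr y) p :=
      MvPolynomial.polyMap_eval (fun i => (b.coord i).polyMap) p
    obtain ⟨x, hx⟩ := h _ hpoly ⟨b.equivFun.symm v, by
      rw [← b.equivFun_apply]; simpa using hv⟩
    rw [← key, hp] at hx
    exact hx rfl

theorem PolyMap.exists_vanishing_of_finrank_lt [Infinite k] [FiniteDimensional k M]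
    [FiniteDimensional k N] {Φ : M → N} (hΦ : PolyMap k Φ) (h : finrank k M < finrank k N) :
    ∃ g : N → k, PolyMap k g ∧ (∃ y, g y ≠ 0) ∧ ∀ x, g (Φ x) = 0 := by
  by_contra! H
  have := ((hΦ.algebraicIndependent_coords (finBasis k N)).2 H).lift_cardinalMk_le_trdeg
  rw [trdeg_polyFn] at this
  simp at this
  omega

theorem PolyMap.isAlgebraic_of_finrank_eq [Infinite k] [FiniteDimensional k M]
    [FiniteDimensional k N] {Φ : M → N} (hΦ : PolyMap k Φ) (h : finrank k M = finrank k N)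
    (hdom : ∀ g : N → k, PolyMap k g → (∃ y, g y ≠ 0) → ∃ x, g (Φ x) ≠ 0) (u : PolyFn k M) :
    IsAlgebraic (MvPolynomial.aeval (R := k) (hΦ.coords (finBasis k N))).range u := by
  have := AlgebraicIndependent.isTranscendenceBasis_of_lift_trdeg_le_of_finite
    ((hΦ.algebraicIndependent_coords (finBasis k N)).2 hdom) (by rw [trdeg_polyFn]; simp [h])
  have := this.isAlgebraic.1 u
  rwa [Algebra.adjoin_range_eq_range_aeval] at this

theorem PolyMap.exists_relation [Infinite k] [FiniteDimensional k M]
    [FiniteDimensional k N] {Φ : M → N} (hΦ : PolyMap k Φ) (h : finrank k M = finrank k N)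
    (hdom : ∀ g : N → k, PolyMap k g → (∃ y, g y ≠ 0) → ∃ x, g (Φ x) ≠ 0)
    {u : M → k} (hu : PolyMap k u) (hu0 : ∃ x, u x ≠ 0) :
    ∃ (d : ℕ) (c : ℕ → N → k), (∀ i, PolyMap k (c i)) ∧ (∃ y, c 0 y ≠ 0) ∧
      ∀ x, ∑ i ∈ Finset.range (d + 1), c i (Φ x) * u x ^ i = 0 := by
  let b := finBasis k N
  have halg := hΦ.isAlgebraic_of_finrank_eq h hdom ⟨u, PolyMap.iff_mem.1 hu⟩
  obtain ⟨q, hq0, hq⟩ := halg.exists_nonzero_coeff_and_aeval_eq_zero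
    (mem_nonZeroDivisors_of_ne_zero fun h0 => by
      obtain ⟨x, hx⟩ := hu0
      exact hx (congrFun (congrArg Subtype.val h0) x))
  choose p hp using fun i => (q.coeff i).2
  have key : ∀ i x, (q.coeff i).1.1 x = MvPolynomial.eval (b.repr (Φ x)) (p i) := by
    intro i x
    rw [← hp]
    exact aeval_polyFn_apply _ _ _
  refine ⟨q.natDegree, fun i y => MvPolynomial.eval (b.repr y) (p i), fun i =>
    MvPolynomial.polyMap_eval (fun i => (b.coord i).polyMap) _, ?_, fun x => ?_⟩
  · by_contra! h0
    refine hq0 (Subtype.ext (Subtype.ext (funext fun x => ?_)))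
    rw [key, h0]
    rfl
  · rw [Polynomial.aeval_eq_sum_range] at hq
    have := congrFun (congrArg Subtype.val hq) x
    simp only [← key]
    simpa [Subalgebra.smul_def, Finset.sum_apply] using this

theorem PolyMap.eventually_fiber_ne_zero [Infinite k] [FiniteDimensional k M]
    [FiniteDimensional k N] {Φ : M → N} (hΦ : PolyMap k Φ) (h : finrank k M = finrank k N)
    {u : M → k} (hu : PolyMap k u) (hu0 : ∃ x, u x ≠ 0) :
    ∀ᶠ y in zar k N, ∀ x, Φ x = y → u x ≠ 0 := by
  by_cases hdom : ∀ g : N → k, PolyMap k g → (∃ y, g y ≠ 0) → ∃ x, g (Φ x) ≠ 0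
  · obtain ⟨d, c, hc, ⟨y, hy⟩, hrel⟩ := hΦ.exists_relation h hdom hu hu0
    filter_upwards [(hc 0).eventually_ne hy] with y hy
    rintro x rfl hx
    have := hrel x
    rw [Finset.sum_range_succ', hx] at this
    simp [hy] at this
  · push Not at hdom
    obtain ⟨g, hg, ⟨y, hy⟩, h0⟩ := hdom
    filter_upwards [hg.eventually_ne hy] with y hy
    rintro x rfl
    exact (hy (h0 x)).elim

theorem PolyMap.eventually_fiber_finite [Infinite k] [FiniteDimensional k M]
    [FiniteDimensional k N] {Φ : M → N} (hΦ : PolyMap k Φ) (h : finrank k M = finrank k N)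
    {u : M → k} (hu : PolyMap k u) :
    ∀ᶠ y in zar k N, (u '' {x | Φ x = y}).Finite := by
  by_cases hu0 : ∃ x, u x ≠ 0
  swap
  · push Not at hu0
    refine Filter.Eventually.of_forall fun y => (Set.finite_singleton 0).subset ?_
    rintro _ ⟨x, -, rfl⟩
    exact hu0 x
  by_cases hdom : ∀ g : N → k, PolyMap k g → (∃ y, g y ≠ 0) → ∃ x, g (Φ x) ≠ 0
  · obtain ⟨d, c, hc, ⟨y, hy⟩, hrel⟩ := hΦ.exists_relation h hdom hu hu0
    filter_upwards [(hc 0).eventually_ne hy] with y hy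
    let P : Polynomial k := ∑ i ∈ Finset.range (d + 1), Polynomial.C (c i y) * Polynomial.X ^ i
    have hP : P ≠ 0 := fun h0 => hy (by
      have := congrArg (fun P => P.coeff 0) h0
      simpa [P, Polynomial.coeff_zero_eq_eval_zero, Polynomial.eval_finsetSum,
        Finset.sum_range_succ'] using this)
    refine (Polynomial.finite_setOfPred_isRoot hP).subset ?_
    rintro _ ⟨x, rfl, rfl⟩
    simpa [P, Polynomial.eval_finsetSum] using hrel x
  · push Not at hdom
    obtain ⟨g, hg, ⟨y, hy⟩, h0⟩ := hdom
    filter_upwards [hg.eventually_ne hy] with y hy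
    refine Set.finite_empty.subset ?_
    rintro _ ⟨x, rfl, rfl⟩
    exact (hy (h0 x)).elim

theorem isAlgebraic_of_mul_eq {R A : Type*} [CommRing R] [CommRing A] [Algebra R A] {a : A}
    {d e : R} (hd : d ≠ 0) (h : algebraMap R A d * a = algebraMap R A e) : IsAlgebraic R a := by
  refine ⟨Polynomial.C d * Polynomial.X - Polynomial.C e, fun h0 => hd ?_, by simp [h]⟩
  simpa [Polynomial.coeff_C] using congrArg (fun P => P.coeff 1) h0

theorem PolyMap.exists_dominant_extension [Infinite k] [FiniteDimensional k M]
    [FiniteDimensional k N] {Φ : M → N} (hΦ : PolyMap k Φ)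
    (hdom : ∀ g : N → k, PolyMap k g → (∃ y, g y ≠ 0) → ∃ x, g (Φ x) ≠ 0)
    {β : Type*} [Finite β] {ξ : β → M → k} (hξ : ∀ i, PolyMap k (ξ i))
    {ι : Type*} [Finite ι] (b : Basis ι k M)
    (hgen : ∀ i, ∃ D ∈ Algebra.adjoin k (Set.range (fun l : Dual k N => fun x => l (Φ x)) ∪
      Set.range ξ), D ≠ 0 ∧ D * (b.coord i : M → k) ∈
        Algebra.adjoin k (Set.range (fun l : Dual k N => fun x => l (Φ x)) ∪ Set.range ξ)) :
    ∃ B : Finset β, B.card + finrank k N = finrank k M ∧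
      ∀ g : N × (B → k) → k, PolyMap k g → (∃ y, g y ≠ 0) →
        ∃ x, g (Φ x, fun i => ξ i x) ≠ 0 := by
  classical
  let bN := finBasis k N
  let y := hΦ.coords bN
  let z : β → PolyFn k M := fun i => ⟨ξ i, PolyMap.iff_mem.1 (hξ i)⟩
  have hy : AlgebraicIndependent k y := (hΦ.algebraicIndependent_coords bN).2 hdom
  let t : Set (PolyFn k M) := Set.range y ∪ Set.range z
  have hsub : ∀ D ∈ Algebra.adjoin k (Set.range (fun l : Dual k N => fun x => l (Φ x)) ∪
      Set.range ξ), ∃ D' ∈ Algebra.adjoin k t, D'.1 = D := by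
    intro D hD
    have : Algebra.adjoin k (Set.range (fun l : Dual k N => fun x => l (Φ x)) ∪ Set.range ξ) ≤
        (Algebra.adjoin k t).map (PolyFn k M).val := by
      refine Algebra.adjoin_le ?_
      rintro _ (⟨l, rfl⟩ | ⟨i, rfl⟩)
      · refine ⟨∑ i, l (bN i) • y i, (Algebra.adjoin k t).sum_mem fun i _ =>
          (Algebra.adjoin k t).smul_mem (Algebra.subset_adjoin (Or.inl ⟨i, rfl⟩)) _,
          funext fun x => ?_⟩
        change _ = l (Φ x)
        conv_rhs => rw [← bN.sum_repr (Φ x)]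
        simp [-Basis.sum_repr, y, PolyMap.coords, Finset.sum_apply, mul_comm]
      · exact ⟨z i, Algebra.subset_adjoin (Or.inr ⟨i, rfl⟩), rfl⟩
    obtain ⟨D', hD', h⟩ := this hD
    exact ⟨D', hD', h⟩
  have halg : Algebra.IsAlgebraic (Algebra.adjoin k t) (PolyFn k M) := by
    let S : Subalgebra k (PolyFn k M) :=
      (Subalgebra.algebraicClosure (Algebra.adjoin k t) (PolyFn k M)).restrictScalars k
    have hS : ∀ i, (polyFnEquiv b (MvPolynomial.X i)) ∈ S := by
      intro i
      obtain ⟨D, hD, hD0, hDb⟩ := hgen i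
      obtain ⟨D', hD', rfl⟩ := hsub D hD
      obtain ⟨E', hE', h⟩ := hsub _ hDb
      change IsAlgebraic (Algebra.adjoin k t) _
      refine isAlgebraic_of_mul_eq (d := ⟨D', hD'⟩) (e := ⟨E', hE'⟩)
        (fun h0 => hD0 (congrArg Subtype.val (congrArg Subtype.val h0))) (Subtype.ext ?_)
      rw [polyFnEquiv_X]
      exact h.symm
    have htop : ∀ p, polyFnEquiv b p ∈ S := by
      intro p
      induction p using MvPolynomial.induction_on with
      | C a => 
        rw [← MvPolynomial.algebraMap_eq, AlgEquiv.commutes]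
        exact S.algebraMap_mem a
      | add p q hp hq => rw [map_add]; exact S.add_mem hp hq
      | mul_X p i hp => rw [map_mul]; exact S.mul_mem hp (hS i)
    refine ⟨fun a => ?_⟩
    have := htop ((polyFnEquiv b).symm a)
    rwa [AlgEquiv.apply_symm_apply] at this
  obtain ⟨u, hsu, hut, hu⟩ := exists_isTranscendenceBasis_between (R := k) (Set.range y) t
    Set.subset_union_left hy.coe_range
  have hpre : ∀ a : (u \ Set.range y : Set _), ∃ i, z i = a.1 := fun a =>
    (hut a.2.1).resolve_left a.2.2
  choose j hj using hpre
  have hjinj : Function.Injective j := fun a a' h => Subtype.ext (by rw [← hj, ← hj, h])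
  have hufin : u.Finite := ((Set.finite_range y).union (Set.finite_range z)).subset hut
  have : Finite (u \ Set.range y : Set _) := hufin.subset Set.sdiff_subset
  have := Fintype.ofFinite (u \ Set.range y : Set _)
  let B : Finset β := Finset.univ.image j
  have hB : ∀ i : B, ∃ a, j a = i := fun i => by
    obtain ⟨a, -, ha⟩ := Finset.mem_image.1 i.2
    exact ⟨a, ha⟩
  choose j' hj' using hB
  have hz : ∀ i : B, z i = j' i := fun i => by rw [← hj, hj']
  have hj'j : ∀ a (h : j a ∈ B), j' ⟨j a, h⟩ = a := fun a h => hjinj (hj' _)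
  let e : Fin (finrank k N) ⊕ B → u := Sum.elim (fun i => ⟨y i, hsu ⟨i, rfl⟩⟩)
    (fun i => ⟨z i, by rw [hz]; exact (j' i).2.1⟩)
  have he : Function.Bijective e := by
    constructor
    · rintro (i | i) (i' | i') h
      · simpa [e] using hy.injective (congrArg Subtype.val h)
      · exact ((j' i').2.2 ⟨i, by rw [← hz]; exact congrArg Subtype.val h⟩).elim
      · exact ((j' i).2.2 ⟨i', by rw [← hz]; exact (congrArg Subtype.val h).symm⟩).elim
      · have h1 : z i = z i' := congrArg Subtype.val h
        rw [hz, hz] at h1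
        have := congrArg j (Subtype.ext h1)
        rw [hj', hj'] at this
        rw [Subtype.ext this]
    · rintro ⟨a, ha⟩
      by_cases h : a ∈ Set.range y
      · obtain ⟨i, rfl⟩ := h
        exact ⟨Sum.inl i, rfl⟩
      · exact ⟨Sum.inr ⟨j ⟨a, ha, h⟩, by simp [B]⟩, Subtype.ext (hj ⟨a, ha, h⟩)⟩
  have hcard := (hu.1.comp e he.1 |>.isTranscendenceBasis_iff_isAlgebraic.2 (by
    rw [he.2.range_comp]; exact hu.isAlgebraic)).lift_cardinalMk_eq_trdeg
  rw [trdeg_polyFn] at hcard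
  have hind : AlgebraicIndependent k (Sum.elim y fun i : B => z i) := by
    have := hu.1.comp e he.1
    convert this
    ext1 (i | i) <;> rfl
  refine ⟨B, by simp at hcard; rw [add_comm]; exact_mod_cast hcard, fun g hg => ?_⟩
  let bb : Basis (Fin (finrank k N) ⊕ B) k (N × (B → k)) := bN.prod (Pi.basisFun k B)
  have hΦ' : PolyMap k fun x => (Φ x, fun i : B => ξ i x) :=
    hΦ.prodMk (PolyMap.pi fun i => hξ i)
  refine (hΦ'.algebraicIndependent_coords bb).1 ?_ g hg
  convert hind
  ext1 (i | i) <;> exact Subtype.ext (funext fun x => by simp [PolyMap.coords, bb, y, z])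

end trdeg

/-! ### Position of a subspace with respect to a family of vectors -/

section Pos

variable {k V V' U : Type*} [Field k] [AddCommGroup V] [Module k V] [AddCommGroup V'] [Module k V']
  [AddCommGroup U] [Module k U] {ι ρ τ σ : Type*} [LinearOrder ι]

/-- The subspace `S` contains, for every `a`, a vector with leading term `b (I a)` with respect to
the ordered family `b`. -/
def Pos (I : ρ → ι) (b : ι → V) (S : Submodule k V) : Prop :=
  ∀ a, ∃ f ∈ S, f - b (I a) ∈ span k (b '' Set.Iio (I a))

theorem Pos.span_le [WellFoundedLT ι] {I : ρ → ι} {b : ι → V} {S : Submodule k V}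
    (h : Pos I b S) (c : ι) :
    span k (b '' Set.Iio c) ≤ S ⊔ span k (b '' {c' | c' < c ∧ c' ∉ Set.range I}) := by
  induction c using WellFoundedLT.induction with
  | ind c ih =>
  rw [Submodule.span_le]
  rintro _ ⟨c', hc', rfl⟩
  by_cases hr : c' ∈ Set.range I
  · obtain ⟨a, rfl⟩ := hr
    obtain ⟨f, hf, hfa⟩ := h a
    have h1 := ih _ hc' hfa
    have hmono : span k (b '' {c' | c' < I a ∧ c' ∉ Set.range I}) ≤
        span k (b '' {c' | c' < c ∧ c' ∉ Set.range I}) :=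
      span_mono (Set.image_mono fun x hx => ⟨hx.1.trans hc', hx.2⟩)
    have h2 := sup_le_sup_left hmono S h1
    have := sub_mem (mem_sup_left (T := span k (b '' {c' | c' < c ∧ c' ∉ Set.range I})) hf) h2
    simpa using this
  · exact mem_sup_right (subset_span ⟨c', ⟨hc', hr⟩, rfl⟩)

theorem Pos.exists_reduced [WellFoundedLT ι] {I : ρ → ι} {b : ι → V} {S : Submodule k V}
    (h : Pos I b S) (a : ρ) :
    ∃ f ∈ S, f - b (I a) ∈ span k (b '' {c | c < I a ∧ c ∉ Set.range I}) := by
  obtain ⟨f, hf, hfa⟩ := h a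
  obtain ⟨s, hs, t, ht, hst⟩ := mem_sup.1 (h.span_le _ hfa)
  refine ⟨f - s, sub_mem hf hs, ?_⟩
  have : f - s - b (I a) = t := by rw [sub_right_comm, ← hst]; simp
  rwa [this]

theorem linearIndependent_of_reduced {I : ρ → ι} (hI : Function.Injective I) {b : ι → V}
    (hb : LinearIndependent k b) {s : ρ → V}
    (hs : ∀ a, s a - b (I a) ∈ span k (b '' (Set.range I)ᶜ)) : LinearIndependent k s := by
  have hd := hb.disjoint_span_image (disjoint_compl_right (a := Set.range I))
  rw [linearIndependent_iff']
  intro T c hc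
  refine linearIndependent_iff'.1 (hb.comp I hI) T c ?_
  refine disjoint_def.1 hd _ (sum_mem fun a _ => smul_mem _ _ (subset_span ⟨I a, ⟨a, rfl⟩, rfl⟩)) ?_
  have : ∑ a ∈ T, c a • (b ∘ I) a = - ∑ a ∈ T, c a • (s a - b (I a)) := by
    simp [smul_sub, Finset.sum_sub_distrib, hc]
  rw [this]
  exact neg_mem (sum_mem fun a _ => smul_mem _ _ (hs a))

theorem Pos.exists_basis [WellFoundedLT ι] [Fintype ρ] [FiniteDimensional k V] {I : ρ → ι}
    (hI : Function.Injective I) {b : ι → V} (hb : LinearIndependent k b) {S : Submodule k V}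
    (hS : finrank k S = Fintype.card ρ) (h : Pos I b S) :
    ∃ s : ρ → V, LinearIndependent k s ∧ span k (Set.range s) = S ∧
      ∀ a, b (I a) - s a ∈ span k (b '' {c | c < I a ∧ c ∉ Set.range I}) := by
  choose s hs hsb using h.exists_reduced
  have hli : LinearIndependent k s := linearIndependent_of_reduced hI hb fun a =>
    span_mono (Set.image_mono fun c hc => hc.2) (hsb a)
  refine ⟨s, hli, ?_, fun a => by simpa using neg_mem (hsb a)⟩
  refine eq_of_le_of_finrank_eq (Submodule.span_le.2 ?_) ?_
  · rintro _ ⟨a, rfl⟩; exact hs a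
  · rw [finrank_span_eq_card hli, hS]

theorem Pos.map {I : ρ → ι} {b : ι → V} {S : Submodule k V} (h : Pos I b S) (e : V →ₗ[k] V') :
    Pos I (fun c => e (b c)) (S.map e) := by
  intro a
  obtain ⟨f, hf, hfa⟩ := h a
  refine ⟨e f, mem_map_of_mem hf, ?_⟩
  have := mem_map_of_mem (f := e) hfa
  rwa [map_span, Set.image_image, map_sub] at this

/-- Replace the members of the family `b` with index `I a` by the vectors `B a`. -/
def replaceFamily (I : ρ → ι) (b : ι → V) (B : ρ → V) : ι → V :=
  open Classical in fun c => if h : ∃ a, I a = c then B h.choose else b c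

theorem replaceFamily_apply {I : ρ → ι} (hI : Function.Injective I) (b : ι → V) (B : ρ → V)
    (a : ρ) : replaceFamily I b B (I a) = B a := by
  have h : ∃ a', I a' = I a := ⟨a, rfl⟩
  rw [replaceFamily, dif_pos h, hI h.choose_spec]

theorem replaceFamily_of_notMem {I : ρ → ι} (b : ι → V) (B : ρ → V) {c : ι}
    (hc : c ∉ Set.range I) : replaceFamily I b B c = b c := dif_neg hc

theorem replaceFamily_self {I : ρ → ι} (hI : Function.Injective I) (b : ι → V) :
    replaceFamily I b (fun a => b (I a)) = b := by
  funext c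
  by_cases hc : c ∈ Set.range I
  · obtain ⟨a, rfl⟩ := hc
    exact replaceFamily_apply hI _ _ _
  · exact replaceFamily_of_notMem _ _ hc

theorem PolyMap.replaceFamily {M : Type*} [AddCommGroup M] [Module k M] [Finite ι] {I : ρ → ι}
    (b : ι → V) {B : M → ρ → V} (hB : ∀ a, PolyMap k fun x => B x a) (c : ι) :
    PolyMap k fun x => replaceFamily I b (B x) c := by
  by_cases hc : ∃ a, I a = c
  · simp only [_root_.replaceFamily, dif_pos hc]
    exact hB _
  · simp only [_root_.replaceFamily, dif_neg hc]
    exact PolyMap.const _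

theorem span_replaceFamily {I : ρ → ι} (b : ι → V) (B : ρ → V) (c : ι) :
    span k (replaceFamily I b B '' {c' | c' < c ∧ c' ∉ Set.range I}) =
      span k (b '' {c' | c' < c ∧ c' ∉ Set.range I}) := by
  congr 1
  exact Set.image_congr fun c hc => replaceFamily_of_notMem _ _ hc.2

theorem Pos.replaceFamily [LinearOrder ρ] {I : ρ → ι} (hI : StrictMono I) (b : ι → V)
    {K : τ → ρ} {B : ρ → U} {S : Submodule k U} (h : Pos K B S) (θ : U →ₗ[k] V) {l : ρ → V}
    (hl : ∀ a, l a ∈ span k (b '' {c | c < I a ∧ c ∉ Set.range I})) :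
    Pos (fun t => I (K t)) (replaceFamily I b fun a => θ (B a) + l a) (S.map θ) := by
  set b' := _root_.replaceFamily I b fun a => θ (B a) + l a with hb'
  have hl' : ∀ a, l a ∈ span k (b' '' Set.Iio (I a)) := fun a => by
    have := hl a
    rw [← span_replaceFamily b (fun a => θ (B a) + l a)] at this
    exact span_mono (Set.image_mono fun c hc => hc.1) this
  have hB : ∀ a, b' (I a) = θ (B a) + l a := fun a => replaceFamily_apply hI.injective _ _ _
  intro t
  obtain ⟨f, hf, hft⟩ := h t
  refine ⟨θ f, mem_map_of_mem hf, ?_⟩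
  have h1 : θ f - b' (I (K t)) = θ (f - B (K t)) - l (K t) := by rw [hB, map_sub]; abel
  rw [h1]
  refine sub_mem ?_ (hl' _)
  have h2 := mem_map_of_mem (f := θ) hft
  rw [map_span, Set.image_image] at h2
  refine Submodule.span_le.2 ?_ h2
  rintro _ ⟨a, ha, rfl⟩
  have h3 : θ (B a) = b' (I a) - l a := by rw [hB]; abel
  simp only [SetLike.mem_coe, h3]
  exact sub_mem (subset_span ⟨I a, hI ha, rfl⟩)
    (span_mono (Set.image_mono fun c hc => lt_trans hc (hI ha)) (hl' a))

end Pos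

/-! ### Types for which subspaces exist for generic families -/

section SubDense

variable {k V V' U : Type*} [Field k] [Infinite k] [AddCommGroup V] [Module k V]
  [AddCommGroup V'] [Module k V'] {ι ρ τ σ : Type*} [LinearOrder ι] [Fintype ι]

theorem eventually_forall_linearIndependent [FiniteDimensional k V] [Finite σ]
    (h : Fintype.card ι ≤ finrank k V) :
    ∀ᶠ b in zar k (σ → ι → V), ∀ j, LinearIndependent k (b j) := by
  rw [Filter.eventually_all]
  intro j
  let e : ι ↪ Fin (finrank k V) := (Function.Embedding.nonempty_of_card_le (by simpa using h)).some
  refine eventually_linearIndependent (v := fun b : σ → ι → V => b j) (fun i => ?_)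
    (x₀ := fun _ i => finBasis k V (e i)) ((finBasis k V).linearIndependent.comp _ e.injective)
  exact (PolyMap.apply i).comp (PolyMap.apply j)

/-- For a dense set of tuples of families `b`, there is a subspace of dimension `card ρ`
of position `I j` with respect to `b j` for all `j`. -/
def SubDense (k V : Type*) [Field k] [Infinite k] [AddCommGroup V] [Module k V] {ι ρ σ : Type*}
    [LinearOrder ι] [Fintype ρ] (I : σ → ρ → ι) : Prop :=
  ∃ᶠ b in zar k (σ → ι → V), ∃ S : Submodule k V,
    finrank k S = Fintype.card ρ ∧ ∀ j, Pos (I j) (b j) S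

theorem SubDense.equiv [Fintype ρ] [Finite σ] {I : σ → ρ → ι} (h : SubDense k V I)
    (e : V ≃ₗ[k] V') : SubDense k V' I := by
  let E : (σ → ι → V) ≃ₗ[k] (σ → ι → V') :=
    LinearEquiv.piCongrRight fun _ => LinearEquiv.piCongrRight fun _ => e
  refine (tendsto_zar_linearEquiv E).frequently (h.mono ?_)
  rintro b ⟨S, hS, hpos⟩
  refine ⟨S.map e.toLinearMap, by rw [LinearEquiv.finrank_map_eq, hS], fun j => (hpos j).map _⟩

theorem SubDense.trans [FiniteDimensional k V] (hV : Fintype.card ι ≤ finrank k V)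
    [Fintype ρ] [LinearOrder ρ] [Fintype τ] [Finite σ] {I : σ → ρ → ι} (hI : ∀ j, StrictMono (I j))
    (h : SubDense k V I) {K : σ → τ → ρ} (hK : SubDense k (ρ → k) K) :
    SubDense k V fun j t => I j (K j t) := by
  rw [SubDense, frequently_zar]
  rintro p hp ⟨b₀, hb₀⟩
  obtain ⟨b, ⟨⟨S, hS, hpos⟩, hpb⟩, hb⟩ := ((h.and_eventually (hp.eventually_ne hb₀)).and_eventually
    (eventually_forall_linearIndependent (σ := σ) hV)).exists
  choose s hs hspan hl using fun j => (hpos j).exists_basis (hI j).injective (hb j) hS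
  obtain ⟨e⟩ : Nonempty ((ρ → k) ≃ₗ[k] S) := ⟨LinearEquiv.ofFinrankEq _ _ (by simp [hS])⟩
  let θ : (ρ → k) →ₗ[k] V := S.subtype ∘ₗ e.toLinearMap
  have hθ : Function.Injective θ := S.injective_subtype.comp e.injective
  have hsmem : ∀ j a, s j a ∈ S := fun j a => by rw [← hspan j]; exact subset_span ⟨a, rfl⟩
  let fam : (σ → ρ → ρ → k) → σ → ι → V := fun B j =>
    replaceFamily (I j) (b j) fun a => θ (B j a) + (b j (I j a) - s j a)
  have hfam : PolyMap k fam := PolyMap.pi fun j => PolyMap.pi fun c => by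
    refine PolyMap.replaceFamily _ (fun a => ?_) c
    have : PolyMap k fun B : σ → ρ → ρ → k => B j a := (PolyMap.apply a).comp (PolyMap.apply j)
    exact (PolyMap.linear_comp θ this).add (PolyMap.const _)
  let B₀ : σ → ρ → ρ → k := fun j a => e.symm ⟨s j a, hsmem j a⟩
  have hB₀ : fam B₀ = b := by
    funext j
    simp only [fam]
    conv_rhs => rw [← replaceFamily_self (hI j).injective (b j)]
    congr 1
    funext a
    simp [θ, B₀]
  obtain ⟨B, ⟨S', hS', hpos'⟩, hB⟩ := (hK.and_eventually
    ((hp.comp hfam).eventually_ne (x := B₀) (by rwa [hB₀]))).exists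
  exact ⟨fam B, hB, S'.map θ, by
    rw [← (Submodule.equivMapOfInjective θ hθ S').finrank_eq, hS'], fun j =>
    (hpos' j).replaceFamily (hI j) (b j) θ (hl j)⟩

end SubDense

/-! ### Generic rank -/

section Rank

variable {k M X Y : Type*} [Field k] [Infinite k] [AddCommGroup M] [Module k M]
  [AddCommGroup X] [Module k X] [AddCommGroup Y] [Module k Y] [FiniteDimensional k Y]

omit [Infinite k] in
theorem exists_basis_range (L : X →ₗ[k] Y) : ∃ u : Fin (finrank k L.range) → X,
    LinearIndependent k (fun i => L (u i)) ∧ span k (Set.range fun i => L (u i)) = L.range := by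
  let b := finBasis k L.range
  choose u hu using fun i => (b i).2
  have h : (fun i => L (u i)) = fun i => L.range.subtype (b i) := funext hu
  refine ⟨u, ?_, ?_⟩
  · rw [h]
    exact b.linearIndependent.map' _ (ker_subtype _)
  · rw [h, Set.range_comp' L.range.subtype b, span_image, b.span_eq, Submodule.map_top, range_subtype]

omit [Infinite k] in
theorem card_le_finrank_range {ι : Type*} [Fintype ι] {L : X →ₗ[k] Y} {v : ι → Y}
    (hv : LinearIndependent k v) (h : ∀ i, v i ∈ L.range) :
    Fintype.card ι ≤ finrank k L.range := by
  rw [← finrank_span_eq_card hv]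
  exact finrank_mono (Submodule.span_le.2 (by rintro _ ⟨i, rfl⟩; exact h i))

theorem eventually_finrank_range_le {L : M → (X →ₗ[k] Y)} (hL : ∀ u, PolyMap k fun x => L x u) :
    ∀ᶠ x in zar k M, ∀ x', finrank k (L x').range ≤ finrank k (L x).range := by
  have hbdd : BddAbove (Set.range fun x => finrank k (L x).range) :=
    ⟨finrank k Y, by rintro _ ⟨x, rfl⟩; exact finrank_le _⟩
  obtain ⟨x₀, hx₀⟩ := Nat.sSup_mem (Set.range_nonempty _) hbdd
  obtain ⟨u, hu, -⟩ := exists_basis_range (L x₀)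
  filter_upwards [eventually_linearIndependent (v := fun x i => L x (u i)) (fun i => hL _) hu]
    with x hx x'
  have h1 := card_le_finrank_range (L := L x) hx fun i => ⟨u i, rfl⟩
  rw [Fintype.card_fin] at h1
  refine (le_csSup hbdd ⟨x', rfl⟩).trans ?_
  rw [← hx₀]
  exact h1

theorem apply_mem_range_of_finrank_le {L L' : X →ₗ[k] Y}
    (h : ∀ t : k, finrank k (L + t • L').range ≤ finrank k L.range) {φ : X} (hφ : L φ = 0) :
    L' φ ∈ L.range := by
  by_contra hn
  obtain ⟨u, hu, hspan⟩ := exists_basis_range L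
  have h0 : LinearIndependent k
      (fun o : Option (Fin _) => o.elim (L' φ) fun i => (L + (0 : k) • L') (u i)) := by
    rw [linearIndependent_option]
    refine ⟨by simpa [Function.comp_def] using hu, ?_⟩
    simpa [Function.comp_def, hspan] using hn
  obtain ⟨t, ht, ht0⟩ := ((eventually_linearIndependent (M := k)
    (v := fun t (o : Option (Fin _)) => o.elim (L' φ) fun i => (L + t • L') (u i))
    (fun o => by
      cases o with
      | none => exact PolyMap.const _
      | some i =>
        simp only [LinearMap.add_apply, LinearMap.smul_apply, Option.elim]
        fun_prop) h0).and (PolyMap.id'.eventually_ne (x := (1 : k)) one_ne_zero)).exists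
  have h2 := card_le_finrank_range (L := L + t • L') ht fun o => by
    cases o with
    | none => exact ⟨t⁻¹ • φ, by simp [hφ, ht0]⟩
    | some i => exact ⟨u i, rfl⟩
  have h3 := h t
  simp at h2
  omega

end Rank

/-! ### The linear conditions on homomorphisms -/

section Constraint

variable {k V Q : Type*} [Field k] [AddCommGroup V] [Module k V] [AddCommGroup Q] [Module k Q]
  {σ ρ κ τ : Type*}

/-- The indices of the linear conditions imposed by the relation `R`. -/
abbrev Blk (R : σ → ρ → κ → Prop) := {t : σ × ρ × κ // ¬ R t.1 t.2.1 t.2.2}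

/-- The values of a homomorphism at the vectors `f j a`, tested by the functionals `h j b`. -/
def constraintMap (R : σ → ρ → κ → Prop) (f : σ → ρ → V) (h : σ → κ → Dual k Q) :
    (V →ₗ[k] Q) →ₗ[k] (Blk R → k) :=
  LinearMap.pi fun t => h t.1.1 t.1.2.2 ∘ₗ LinearMap.applyₗ (f t.1.1 t.1.2.1)

@[simp]
theorem constraintMap_apply (R : σ → ρ → κ → Prop) (f : σ → ρ → V) (h : σ → κ → Dual k Q)
    (φ : V →ₗ[k] Q) (t : Blk R) :
    constraintMap R f h φ t = h t.1.1 t.1.2.2 (φ (f t.1.1 t.1.2.1)) := rfl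

theorem polyMap_constraintMap {M : Type*} [AddCommGroup M] [Module k M] [FiniteDimensional k Q]
    [Finite σ] [Finite ρ] [Finite κ] (R : σ → ρ → κ → Prop) {f : M → σ → ρ → V}
    {h : M → σ → κ → Dual k Q} (hf : ∀ j a, PolyMap k fun x => f x j a)
    (hh : ∀ j b, PolyMap k fun x => h x j b) (φ : V →ₗ[k] Q) :
    PolyMap k fun x => constraintMap R (f x) (h x) φ :=
  PolyMap.pi fun _ => PolyMap.bilin (LinearMap.id : Dual k Q →ₗ[k] Q →ₗ[k] k) (hh _ _)
    (PolyMap.linear_comp φ (hf _ _))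

end Constraint

/-! ### Existence of positions -/

theorem exists_pos {k V : Type*} [Field k] [AddCommGroup V] [Module k V] {n : ℕ} {b : Fin n → V}
    (hb : LinearIndependent k b) (hspan : span k (Set.range b) = ⊤) (S : Submodule k V) :
    ∃ K : Fin (finrank k S) → Fin n, StrictMono K ∧ Pos K b S ∧
      ∀ m : ℕ, finrank k ↥(S ⊓ span k (b '' {a | (a : ℕ) < m})) =
        Fintype.card {t // (K t : ℕ) < m} := by
  classical
  have : FiniteDimensional k V := ⟨⟨Finset.univ.image b, by simpa using hspan⟩⟩
  let J : Finset (Fin n) := Finset.univ.filter fun u => ∃ f ∈ S, f - b u ∈ span k (b '' Set.Iio u)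
  have key : ∀ m : ℕ, finrank k ↥(S ⊓ span k (b '' {a | (a : ℕ) < m})) =
      (J.filter fun u : Fin n => (u : ℕ) < m).card := by
    intro m
    induction m with
    | zero => simp
    | succ m ih =>
      by_cases hm : m < n
      swap
      · have h1 : {a : Fin n | (a : ℕ) < m + 1} = {a : Fin n | (a : ℕ) < m} := by
          ext a; simp; omega
        have h2 : (J.filter fun u : Fin n => (u : ℕ) < m + 1) = J.filter fun u : Fin n => (u : ℕ) < m := by
          ext a; simp; omega
        rw [h1, h2, ih]
      set u : Fin n := ⟨m, hm⟩ with hu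
      have h1 : {a : Fin n | (a : ℕ) < m + 1} = insert u {a : Fin n | (a : ℕ) < m} := by
        ext a; simp [Fin.ext_iff, hu]; omega
      have hIio : {a : Fin n | (a : ℕ) < m} = Set.Iio u := by ext a; simp [Fin.lt_def, hu]
      have hnot : b u ∉ span k (b '' Set.Iio u) :=
        hb.notMem_span_image (by simp)
      have hmem : ∀ x, x ∈ span k (b '' insert u (Set.Iio u)) ↔
          ∃ c : k, ∃ z ∈ span k (b '' Set.Iio u), x = c • b u + z := by
        intro x
        rw [Set.image_insert_eq, mem_span_insert]
      rw [h1]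
      rw [hIio] at ih ⊢
      by_cases huJ : u ∈ J
      · obtain ⟨f, hfS, hf⟩ := (Finset.mem_filter.1 huJ).2
        have h2 : (J.filter fun u : Fin n => (u : ℕ) < m + 1) =
            insert u (J.filter fun u : Fin n => (u : ℕ) < m) := by
          ext a
          simp only [Finset.mem_filter, Finset.mem_insert]
          constructor
          · rintro ⟨h, h'⟩
            by_cases ha : a = u
            · exact Or.inl ha
            · exact Or.inr ⟨h, by simp [Fin.ext_iff, hu] at ha; omega⟩
          · rintro (rfl | ⟨h, h'⟩)
            · exact ⟨huJ, by simp [hu]⟩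
            · exact ⟨h, by omega⟩
        have h3 : S ⊓ span k (b '' insert u (Set.Iio u)) =
            (S ⊓ span k (b '' Set.Iio u)) ⊔ span k {f} := by
          apply le_antisymm
          · rintro x ⟨hxS, hx⟩
            obtain ⟨c, z, hz, rfl⟩ := (hmem x).1 hx
            rw [mem_sup]
            refine ⟨c • b u + z - c • f, ⟨sub_mem hxS (smul_mem _ _ hfS), ?_⟩, c • f,
              smul_mem _ _ (mem_span_singleton_self f), by simp⟩
            have : c • b u + z - c • f = z - c • (f - b u) := by rw [smul_sub]; abel
            rw [this]
            exact sub_mem hz (smul_mem _ _ hf)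
          · refine sup_le (inf_le_inf_left _ (span_mono (Set.image_mono (Set.subset_insert _ _)))) ?_
            rw [span_singleton_le_iff_mem]
            exact ⟨hfS, (hmem f).2 ⟨1, f - b u, hf, by simp⟩⟩
        have hfn : f ∉ S ⊓ span k (b '' Set.Iio u) := by
          rintro ⟨-, h⟩
          exact hnot (by simpa using sub_mem h hf)
        rw [h3, finrank_sup_span_singleton hfn, ih, h2, Finset.card_insert_of_notMem (by simp [hu])]
      · have h2 : (J.filter fun u : Fin n => (u : ℕ) < m + 1) = J.filter fun u : Fin n => (u : ℕ) < m := by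
          ext a
          simp only [Finset.mem_filter, and_congr_right_iff]
          intro h
          have : a ≠ u := by rintro rfl; exact huJ h
          simp [Fin.ext_iff, hu] at this
          omega
        have h3 : S ⊓ span k (b '' insert u (Set.Iio u)) = S ⊓ span k (b '' Set.Iio u) := by
          apply le_antisymm
          · rintro x ⟨hxS, hx⟩
            obtain ⟨c, z, hz, rfl⟩ := (hmem x).1 hx
            refine ⟨hxS, ?_⟩
            by_cases hc : c = 0
            · simpa [hc] using hz
            · refine absurd (Finset.mem_filter.2 ⟨Finset.mem_univ _, c⁻¹ • (c • b u + z),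
                smul_mem _ _ hxS, ?_⟩) huJ
              rw [smul_add, inv_smul_smul₀ hc, add_sub_cancel_left]
              exact smul_mem _ _ hz
          · exact inf_le_inf_left _ (span_mono (Set.image_mono (Set.subset_insert _ _)))
        rw [h3, ih, h2]
  have hcard : J.card = finrank k S := by
    have h := key n
    have h1 : {a : Fin n | (a : ℕ) < n} = Set.univ := by ext a; simp
    rw [h1, Set.image_univ, hspan, inf_top_eq] at h
    rw [h, Finset.filter_true_of_mem fun a _ => a.2]
  refine ⟨J.orderEmbOfFin hcard, (J.orderEmbOfFin hcard).strictMono, fun t =>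
    (Finset.mem_filter.1 (J.orderEmbOfFin_mem hcard t)).2, fun m => ?_⟩
  rw [key, Fintype.card_subtype]
  refine (Finset.card_bij (fun t _ => J.orderEmbOfFin hcard t) ?_ ?_ ?_).symm
  · intro t ht
    simpa using ht
  · intro t _ t' _ h
    exact (J.orderEmbOfFin hcard).injective h
  · intro u hu
    have : u ∈ Set.range (J.orderEmbOfFin hcard) := by
      rw [Finset.range_orderEmbOfFin]; exact (Finset.mem_filter.1 hu).1
    obtain ⟨t, rfl⟩ := this
    exact ⟨t, by simpa using (Finset.mem_filter.1 hu).2, rfl⟩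

section LemmaA

variable {k V Q U : Type*} [Field k] [AddCommGroup V] [Module k V] [AddCommGroup Q] [Module k Q]
  [AddCommGroup U] [Module k U] {σ ρ κ τ : Type*} [LinearOrder ρ]

theorem exists_comp_eq_of_ker_le {φ : V →ₗ[k] Q} {u : V →ₗ[k] U} (h : φ.ker ≤ u.ker) :
    ∃ X : Q →ₗ[k] U, X ∘ₗ φ = u := by
  obtain ⟨X, hX⟩ := LinearMap.exists_extend
    (φ.ker.liftQ u h ∘ₗ φ.quotKerEquivRange.symm.toLinearMap)
  refine ⟨X, LinearMap.ext fun v => ?_⟩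
  have h1 := LinearMap.congr_fun hX ⟨φ v, v, rfl⟩
  have h2 : φ.quotKerEquivRange.symm ⟨φ v, v, rfl⟩ = φ.ker.mkQ v :=
    φ.quotKerEquivRange.symm_apply_eq.2 rfl
  simpa [h2] using h1

theorem surjective_constraintMap_of_ker {R : σ → ρ → κ → Prop} {f : σ → ρ → V}
    (hf : ∀ j, LinearIndependent k (f j)) (hspan : ∀ j, ⊤ ≤ span k (Set.range (f j)))
    {h : σ → κ → Dual k Q} (hh : ∀ j (z : κ → k), ∃ q, ∀ b, h j b q = z b)
    {K : σ → τ → ρ} (hK : ∀ j, Function.Injective (K j)) {B : σ → τ → U}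
    (hB : ∀ j, span k (Set.range (B j)) = ⊤) {θ : U →ₗ[k] V} (hθ : Function.Injective θ)
    (hl : ∀ j t, f j (K j t) - θ (B j t) ∈ span k (f j '' (Set.range (K j))ᶜ))
    (hsurj : Function.Surjective (constraintMap (fun j t => R j (K j t)) B h))
    {φ : V →ₗ[k] Q} (hφ : φ.ker = LinearMap.range θ)
    (hX : ∀ X : σ → Q →ₗ[k] Q, constraintMap R f (fun j b => h j b ∘ₗ X j) φ ∈
      LinearMap.range (constraintMap R f h)) :
    Function.Surjective (constraintMap R f h) := by
  classical
  intro y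
  let bas j := Basis.mk (hf j) (hspan j)
  have hbas : ∀ j c, bas j c = f j c := fun j c => Basis.mk_apply _ _ _
  choose q hq using fun j c => hh j fun b => if hc : R j c b then 0 else y ⟨(j, c, b), hc⟩
  let D j : V →ₗ[k] Q := (bas j).constr k (replaceFamily (K j) (q j) 0)
  obtain ⟨χ, hχ⟩ := hsurj fun t => y ⟨(t.1.1, K t.1.1 t.1.2.1, t.1.2.2), t.2⟩ -
    h t.1.1 t.1.2.2 (D t.1.1 (f t.1.1 (K t.1.1 t.1.2.1) - θ (B t.1.1 t.1.2.1)))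
  let u j : V →ₗ[k] Q := (bas j).constr k (replaceFamily (K j) (q j) fun t =>
    χ (B j t) + D j (f j (K j t) - θ (B j t)))
  have hD : ∀ j c, c ∉ Set.range (K j) → D j (f j c) = q j c := fun j c hc => by
    rw [← hbas, Basis.constr_basis, replaceFamily_of_notMem _ _ hc]
  have hu : ∀ j c, c ∉ Set.range (K j) → u j (f j c) = q j c := fun j c hc => by
    rw [← hbas, Basis.constr_basis, replaceFamily_of_notMem _ _ hc]
  have huK : ∀ j t, u j (f j (K j t)) = χ (B j t) + D j (f j (K j t) - θ (B j t)) :=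
    fun j t => by
      rw [← hbas j, Basis.constr_basis, replaceFamily_apply (hK j), hbas]
  have hDu : ∀ j t, D j (f j (K j t) - θ (B j t)) = u j (f j (K j t) - θ (B j t)) := by
    intro j t
    refine LinearMap.eqOn_span ?_ (hl j t)
    rintro _ ⟨c, hc, rfl⟩
    rw [hD j c hc, hu j c hc]
  have huθ : ∀ j, u j ∘ₗ θ = χ := fun j => by
    refine LinearMap.ext_on (hB j) ?_
    rintro _ ⟨t, rfl⟩
    have h1 := huK j t
    rw [hDu, map_sub] at h1
    rw [LinearMap.comp_apply]
    exact (eq_sub_of_add_eq h1.symm).trans (sub_sub_cancel _ _) |>.symm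
  obtain ⟨π, hπ⟩ := θ.exists_leftInverse_of_injective (LinearMap.ker_eq_bot.2 hθ)
  have hker : ∀ j, φ.ker ≤ (u j - χ ∘ₗ π).ker := by
    intro j
    rw [hφ]
    rintro _ ⟨x, rfl⟩
    have h1 := LinearMap.congr_fun (huθ j) x
    have h2 := LinearMap.congr_fun hπ x
    simp only [LinearMap.comp_apply, LinearMap.id_apply] at h1 h2
    simp [h1, h2]
  choose X hX' using fun j => exists_comp_eq_of_ker_le (hker j)
  obtain ⟨ψ, hψ⟩ := hX X
  refine ⟨ψ + χ ∘ₗ π, ?_⟩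
  funext ⟨⟨j, a, b⟩, ht⟩
  have h1 : h j b (u j (f j a)) = y ⟨(j, a, b), ht⟩ := by
    by_cases ha : a ∈ Set.range (K j)
    · obtain ⟨t, rfl⟩ := ha
      have := congr_fun hχ ⟨(j, t, b), ht⟩
      simp only [constraintMap_apply] at this
      rw [huK, map_add, this]
      simp
    · rw [hu j a ha, hq, dif_neg ht]
  have h2 := LinearMap.congr_fun (hX' j) (f j a)
  have h3 := congr_fun hψ ⟨(j, a, b), ht⟩
  simp only [constraintMap_apply, LinearMap.comp_apply, LinearMap.sub_apply] at h2 h3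
  rw [map_add, Pi.add_apply, hψ, ← h1]
  simp [h2]

/-- If the linear conditions are never independent, then there is a dimension `d` and there are
positions `K` such that generic families admit a `d`-dimensional subspace of position `K`, and the
restrictions of the conditions to this subspace are too many. -/
theorem exists_subDense_of_not_surjective {k : Type*} [Field k] [Infinite k] {σ κ : Type*}
    [Finite σ] [Fintype κ] (r : ℕ) (R : σ → Fin r → κ → Prop)
    (hns : ¬ ∃ (f : σ → Fin r → Fin r → k) (h : σ → κ → Dual k (κ → k)),
      Function.Surjective (constraintMap R f h)) :
    ∃ (d : ℕ) (K : σ → Fin d → Fin r), (∀ j, StrictMono (K j)) ∧ SubDense k (Fin r → k) K ∧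
      d * Fintype.card κ < Nat.card (Blk fun j t => R j (K j t)) := by
  classical
  have := Fintype.ofFinite σ
  induction r using Nat.strong_induction_on with
  | _ r ih =>
  by_cases hcard : r * Fintype.card κ < Nat.card (Blk R)
  · refine ⟨r, fun _ => id, fun _ => strictMono_id, ?_, hcard⟩
    refine Filter.Eventually.frequently (Filter.Eventually.of_forall fun b => ⟨⊤, by simp, ?_⟩)
    exact fun j a => ⟨b j a, mem_top, by simp⟩
  have hfst : Filter.Tendsto Prod.fst (zar k ((σ → Fin r → Fin r → k) × (σ → κ → Dual k (κ → k)))) (zar k (σ → Fin r → Fin r → k)) :=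
    (PolyMap.fst PolyMap.id').tendsto_zar Prod.fst_surjective
  have hsnd : Filter.Tendsto Prod.snd (zar k ((σ → Fin r → Fin r → k) × (σ → κ → Dual k (κ → k)))) (zar k (σ → κ → Dual k (κ → k))) :=
    (PolyMap.snd PolyMap.id').tendsto_zar Prod.snd_surjective
  have hrank : ∀ᶠ x in zar k ((σ → Fin r → Fin r → k) × (σ → κ → Dual k (κ → k))), ∀ x' : (σ → Fin r → Fin r → k) × (σ → κ → Dual k (κ → k)), finrank k (constraintMap R x'.1 x'.2).range ≤
      finrank k (constraintMap R x.1 x.2).range :=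
    eventually_finrank_range_le fun φ => polyMap_constraintMap R (by fun_prop) (by fun_prop) φ
  have hli : ∀ᶠ x in zar k ((σ → Fin r → Fin r → k) × (σ → κ → Dual k (κ → k))), ∀ j, LinearIndependent k (x.1 j) :=
    hfst.eventually (eventually_forall_linearIndependent (by simp))
  have hpos : ∀ᶠ x in zar k ((σ → Fin r → Fin r → k) × (σ → κ → Dual k (κ → k))), ∀ (d : Fin (r + 1)) (K : σ → Fin d → Fin r),
      ¬ SubDense k (Fin r → k) K → ¬ ∃ S : Submodule k (Fin r → k),
        finrank k S = Fintype.card (Fin d) ∧ ∀ j, Pos (K j) (x.1 j) S := by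
    simp only [Filter.eventually_all]
    intro d K hK
    exact hfst.eventually (Filter.not_frequently.1 hK)
  have hsub : ∀ᶠ x in zar k ((σ → Fin r → Fin r → k) × (σ → κ → Dual k (κ → k))), ∀ (d : Fin (r + 1)) (K : σ → Fin d → Fin r),
      (∃ (f : σ → Fin d → Fin d → k) (h : σ → κ → Dual k (κ → k)),
        Function.Surjective (constraintMap (fun j t => R j (K j t)) f h)) →
      ∃ f : σ → Fin d → Fin d → k,
        Function.Surjective (constraintMap (fun j t => R j (K j t)) f x.2) := by
    simp only [Filter.eventually_all]
    rintro d K ⟨f, h, hs⟩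
    have h1 : ∀ᶠ h in zar k (σ → κ → Dual k (κ → k)),
        Function.Surjective (constraintMap (fun j t => R j (K j t)) f h) :=
      eventually_surjective (fun φ => polyMap_constraintMap _ (by fun_prop) (by fun_prop) φ) hs
    filter_upwards [hsnd.eventually h1] with x hx using ⟨f, hx⟩
  have hdual : ∀ᶠ x in zar k ((σ → Fin r → Fin r → k) × (σ → κ → Dual k (κ → k))), ∀ j, Function.Surjective
      (LinearMap.pi (x.2 j) : (κ → k) →ₗ[k] κ → k) := by
    rw [Filter.eventually_all]
    intro j
    refine eventually_surjective (x₀ := (0, fun _ b => LinearMap.proj b)) (fun q => ?_) fun z =>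
      ⟨z, by ext; simp⟩
    refine PolyMap.pi fun b => ?_
    have : PolyMap k fun x : (σ → Fin r → Fin r → k) × (σ → κ → Dual k (κ → k)) => x.2 j b := by fun_prop
    exact PolyMap.linear_comp (LinearMap.applyₗ q) this
  obtain ⟨⟨f, h⟩, hrank, hli, hpos, hsub, hdual⟩ :=
    (hrank.and (hli.and (hpos.and (hsub.and hdual)))).exists
  simp only at hli hpos hsub hdual
  have hdual' : ∀ j (z : κ → k), ∃ q, ∀ b, h j b q = z b := fun j z => by
    obtain ⟨q, hq⟩ := hdual j z
    exact ⟨q, fun b => congr_fun hq b⟩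
  obtain ⟨φ, hφL, hφ0⟩ : ∃ φ, constraintMap R f h φ = 0 ∧ φ ≠ 0 := by
    by_contra! hc
    have hinj : Function.Injective (constraintMap R f h) :=
      (injective_iff_map_eq_zero _).2 hc
    have h1 : finrank k ((Fin r → k) →ₗ[k] κ → k) = r * Fintype.card κ := by
      rw [finrank_linearMap]; simp
    have h3 := Nat.card_eq_fintype_card (α := Blk R)
    have h2 := LinearMap.finrank_le_finrank_of_injective hinj
    rw [h1, finrank_fintype_fun_eq_card] at h2
    refine hns ⟨f, h, (LinearMap.injective_iff_surjective_of_finrank_eq_finrank ?_).1 hinj⟩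
    rw [h1, finrank_fintype_fun_eq_card]
    omega
  set S := φ.ker with hS
  set d := finrank k S with hd
  have hdr : d < r := by
    have hlt : S < ⊤ := lt_top_iff_ne_top.2 fun hc => hφ0 (LinearMap.ker_eq_top.1 hc)
    simpa using Submodule.finrank_lt_finrank_of_lt hlt
  choose K hK hKpos using fun j => (exists_pos (hli j)
    ((hli j).span_eq_top_of_card_eq_finrank' (by simp)) S)
  have hKdense : SubDense k (Fin r → k) K := by
    by_contra hc
    exact hpos ⟨d, by omega⟩ K hc ⟨S, by simp [hd], fun j => (hKpos j).1⟩
  by_cases hsurj : ∃ (f : σ → Fin d → Fin d → k) (h : σ → κ → Dual k (κ → k)),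
        Function.Surjective (constraintMap (fun j t => R j (K j t)) f h)
  swap
  · obtain ⟨d', K', hK', hdense', hlt⟩ := ih d hdr _ hsurj
    exact ⟨d', fun j t => K j (K' j t), fun j => (hK j).comp (hK' j),
      hKdense.trans (by simp) hK hdense', hlt⟩
  exfalso
  obtain ⟨B₁, hB₁⟩ := hsub ⟨d, by omega⟩ K hsurj
  choose s hs hspan hl using fun j =>
    (hKpos j).1.exists_basis (hK j).injective (hli j) (by simp)
  obtain ⟨e⟩ : Nonempty ((Fin d → k) ≃ₗ[k] S) := ⟨LinearEquiv.ofFinrankEq _ _ (by simp [hd])⟩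
  let θ : (Fin d → k) →ₗ[k] (Fin r → k) := S.subtype ∘ₗ e.toLinearMap
  have hθ : Function.Injective θ := S.injective_subtype.comp e.injective
  have hθS : LinearMap.range θ = S := by
    rw [LinearMap.range_comp, LinearEquiv.range, Submodule.map_top, range_subtype]
  have hsmem : ∀ j a, s j a ∈ S := fun j a => by rw [← hspan j]; exact subset_span ⟨a, rfl⟩
  let fam : (σ → Fin d → Fin d → k) → σ → Fin r → Fin r → k := fun B j =>
    replaceFamily (K j) (f j) fun a => θ (B j a) + (f j (K j a) - s j a)
  have hfam : ∀ j a, PolyMap k fun B => fam B j a := fun j c => by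
    refine PolyMap.replaceFamily _ (fun a => ?_) c
    have : PolyMap k fun B : σ → Fin d → Fin d → k => B j a :=
      (PolyMap.apply a).comp (PolyMap.apply j)
    exact (PolyMap.linear_comp θ this).add (PolyMap.const _)
  let B₀ : σ → Fin d → Fin d → k := fun j a => e.symm ⟨s j a, hsmem j a⟩
  have hB₀ : fam B₀ = f := by
    funext j
    simp only [fam]
    conv_rhs => rw [← replaceFamily_self (hK j).injective (f j)]
    congr 1
    funext a
    simp [θ, B₀]
  have h1 : ∀ᶠ B in zar k (σ → Fin d → Fin d → k), ∀ j, LinearIndependent k (fam B j) := by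
    rw [Filter.eventually_all]
    intro j
    exact eventually_linearIndependent (hfam j) (x₀ := B₀) (by rw [hB₀]; exact hli j)
  have h2 : ∀ᶠ B in zar k (σ → Fin d → Fin d → k), ∀ j, LinearIndependent k (B j) :=
    eventually_forall_linearIndependent (by simp)
  have h3 : ∀ᶠ B in zar k (σ → Fin d → Fin d → k),
      Function.Surjective (constraintMap (fun j t => R j (K j t)) B h) :=
    eventually_surjective (fun φ => polyMap_constraintMap _ (by fun_prop) (by fun_prop) φ) hB₁
  have h4 : ∀ᶠ B in zar k (σ → Fin d → Fin d → k),
      ∀ B', finrank k (constraintMap R (fam B') h).range ≤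
        finrank k (constraintMap R (fam B) h).range :=
    eventually_finrank_range_le fun φ => polyMap_constraintMap R hfam (by fun_prop) φ
  obtain ⟨B, h1, h2, h3, h4⟩ := (h1.and (h2.and (h3.and h4))).exists
  have hfamK : ∀ j t, fam B j (K j t) - θ (B j t) = f j (K j t) - s j t := fun j t => by
    simp only [fam, replaceFamily_apply (hK j).injective]
    abel
  have hmem : ∀ j t, fam B j (K j t) - θ (B j t) ∈
      span k (fam B j '' {c | c < K j t ∧ c ∉ Set.range (K j)}) := fun j t => by
    rw [hfamK]
    simp only [fam]
    rw [span_replaceFamily]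
    exact hl j t
  have hφfam : constraintMap R (fam B) h φ = 0 := by
    have hφS : ∀ v ∈ S, φ v = 0 := fun v hv => hv
    have h5 : ∀ j a, φ (fam B j a) = φ (f j a) := by
      intro j a
      by_cases ha : a ∈ Set.range (K j)
      · obtain ⟨t, rfl⟩ := ha
        rw [eq_add_of_sub_eq (hfamK j t), map_add, map_sub, hφS _ (hsmem j t),
          hφS (θ _) (hθS ▸ LinearMap.mem_range_self θ _)]
        simp
      · simp only [fam, replaceFamily_of_notMem _ _ ha]
    rw [← hφL]
    funext t
    simp only [constraintMap_apply, h5]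
  refine hns ⟨fam B, h, surjective_constraintMap_of_ker h1 (fun j => ?_) hdual'
    (fun j => (hK j).injective) (fun j => ?_) hθ (fun j t => ?_) h3
    (hS.symm.trans hθS.symm) fun X => ?_⟩
  · exact ((h1 j).span_eq_top_of_card_eq_finrank' (by simp)).ge
  · exact (h2 j).span_eq_top_of_card_eq_finrank' (by simp)
  · exact span_mono (Set.image_mono fun c hc => hc.2) (hmem j t)
  · refine apply_mem_range_of_finrank_le (fun t => ?_) hφfam
    have h5 : constraintMap R (fam B) h + t • constraintMap R (fam B) (fun j b => h j b ∘ₗ X j) =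
        constraintMap R (fam B) (fun j b => h j b + t • (h j b ∘ₗ X j)) := by
      ext
      simp
    rw [h5]
    refine (hrank (fam B, _)).trans ?_
    have := h4 B₀
    rwa [hB₀] at this

end LemmaA

/-! ### Parametrization of pairs consisting of a subspace and families of vectors -/

section Param

variable {k σ ρ κ ι : Type*} [Field k] [Fintype σ] [Fintype ρ] [Fintype κ] [DecidableEq κ]
  [LinearOrder ι]

/-- `Prec e j a b` holds if the index `b` of the complement precedes the index `a`. -/
def Prec (e : σ → ρ ⊕ κ ≃ ι) : σ → ρ → κ → Prop := fun j a b => e j (.inr b) < e j (.inl a)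

/-- The index set of the coordinates of the parameter space. -/
abbrev ParIdx (e : σ → ρ ⊕ κ ≃ ι) :=
  (ρ × κ) ⊕ (σ × ρ × ρ) ⊕ (σ × κ × ρ) ⊕ (σ × κ × κ) ⊕ {t : σ × ρ × κ // Prec e t.1 t.2.1 t.2.2}

variable {e : σ → ρ ⊕ κ ≃ ι}

/-- The matrix of the linear map whose graph is the parametrized subspace. -/
def parX (p : ParIdx e → k) : Matrix ρ κ k := fun a b => p (.inl (a, b))

/-- The first components of the vectors with index in `ρ`. -/
def parY (j : σ) (p : ParIdx e → k) : Matrix ρ ρ k := fun a c => p (.inr (.inl (j, a, c)))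

/-- The first components of the vectors with index in `κ`. -/
def parU (j : σ) (p : ParIdx e → k) : Matrix κ ρ k := fun b c => p (.inr (.inr (.inl (j, b, c))))

/-- The second components of the vectors with index in `κ`. -/
def parV (j : σ) (p : ParIdx e → k) : Matrix κ κ k :=
  fun b c => p (.inr (.inr (.inr (.inl (j, b, c)))))

/-- The coefficients expressing that the position is the prescribed one. -/
def parZ (j : σ) (p : ParIdx e → k) : Matrix ρ κ k := open Classical in
  fun a b => if h : Prec e j a b then p (.inr (.inr (.inr (.inr ⟨(j, a, b), h⟩)))) else 0

/-- The images of the vectors with index in `κ` modulo the parametrized subspace. -/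
def parG (j : σ) (p : ParIdx e → k) : Matrix κ κ k := parV j p - parU j p * parX p

/-- The first components of the basis of the parametrized subspace adapted to the families. -/
def parF (j : σ) (p : ParIdx e → k) : Matrix ρ ρ k := parY j p - parZ j p * parU j p

/-- The parametrized families of vectors. -/
def parMap (p : ParIdx e → k) (j : σ) (i : ι) : (ρ → k) × (κ → k) :=
  ((e j).symm i).elim
    (fun a => (parY j p a, (parY j p * parX p + parZ j p * parG j p) a))
    (fun b => (parU j p b, parV j p b))

omit [Fintype σ] [DecidableEq κ] in
theorem parMap_inl (p : ParIdx e → k) (j : σ) (a : ρ) : parMap p j (e j (.inl a)) =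
    (parY j p a, (parY j p * parX p + parZ j p * parG j p) a) := by simp [parMap]

omit [Fintype σ] [DecidableEq κ] in
theorem parMap_inr (p : ParIdx e → k) (j : σ) (b : κ) :
    parMap p j (e j (.inr b)) = (parU j p b, parV j p b) := by simp [parMap]

omit [Fintype σ] [Fintype ρ] [Fintype κ] [DecidableEq κ] in
theorem parZ_eq_zero (j : σ) (p : ParIdx e → k) {a : ρ} {b : κ} (h : ¬ Prec e j a b) :
    parZ j p a b = 0 := dif_neg h

/-- The parameter with prescribed matrices. -/
def parMk (X : Matrix ρ κ k) (Y : σ → Matrix ρ ρ k) (U : σ → Matrix κ ρ k) (V : σ → Matrix κ κ k)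
    (Z : σ → ρ → κ → k) : ParIdx e → k :=
  Sum.elim (fun t => X t.1 t.2) <| Sum.elim (fun t => Y t.1 t.2.1 t.2.2) <|
    Sum.elim (fun t => U t.1 t.2.1 t.2.2) <| Sum.elim (fun t => V t.1 t.2.1 t.2.2)
      fun t => Z t.1.1 t.1.2.1 t.1.2.2

omit [Fintype σ] [Fintype ρ] [Fintype κ] [DecidableEq κ] in
theorem parZ_parMk (X : Matrix ρ κ k) (Y : σ → Matrix ρ ρ k) (U : σ → Matrix κ ρ k)
    (V : σ → Matrix κ κ k) {Z : σ → ρ → κ → k} (hZ : ∀ j a b, ¬ Prec e j a b → Z j a b = 0) (j : σ)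
    (a : ρ) : parZ j (parMk X Y U V Z : ParIdx e → k) a = Z j a := by
  funext b
  by_cases hb : Prec e j a b
  · simp only [parZ, dif_pos hb]; rfl
  · simp only [parZ, dif_neg hb, hZ j a b hb]

/-- The subspace of all vectors `(v, v X)`. -/
def rowGraph (X : Matrix ρ κ k) : Submodule k ((ρ → k) × (κ → k)) := (Matrix.vecMulLinear X).graph

omit [Fintype κ] [DecidableEq κ] in
theorem mem_rowGraph {X : Matrix ρ κ k} {v : (ρ → k) × (κ → k)} :
    v ∈ rowGraph X ↔ v.2 = Matrix.vecMul v.1 X := LinearMap.mem_graph_iff _ _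

theorem mul_row {l m n : Type*} [Fintype m] (A : Matrix l m k) (B : Matrix m n k) (a : l) :
    (A * B) a = Matrix.vecMul (A a) B := Matrix.mul_apply_eq_vecMul A B a

omit [Fintype σ] [DecidableEq κ] in
/-- The vectors of the parametrized subspace adapted to the families. -/
theorem parF_eq (p : ParIdx e → k) (j : σ) (a : ρ) :
    ((parF j p a, Matrix.vecMul (parF j p a) (parX p)) : (ρ → k) × (κ → k)) =
      parMap p j (e j (.inl a)) - ∑ b, parZ j p a b • parMap p j (e j (.inr b)) := by
  simp only [parMap_inl, parMap_inr]
  ext c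
  · simp [parF, Matrix.mul_apply, Prod.fst_sum]
  · simp only [parF, ← mul_row, parG, Matrix.sub_mul, Matrix.mul_sub, Matrix.mul_assoc]
    simp only [Matrix.sub_apply, Matrix.add_apply, Prod.snd_sub, Prod.snd_sum, Prod.smul_mk, Pi.sub_apply,
      Finset.sum_apply, Pi.smul_apply, smul_eq_mul]
    rw [Matrix.mul_apply (M := parZ j p) (N := parV j p)]
    ring

omit [Fintype σ] [DecidableEq κ] in
theorem pos_parMap (p : ParIdx e → k) (j : σ) :
    Pos (fun a => e j (.inl a)) (parMap p j) (rowGraph (parX p)) := by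
  intro a
  refine ⟨(parF j p a, Matrix.vecMul (parF j p a) (parX p)), mem_rowGraph.2 rfl, ?_⟩
  rw [parF_eq, sub_sub_cancel_left]
  refine neg_mem (sum_mem fun b _ => ?_)
  by_cases h : Prec e j a b
  · exact smul_mem _ _ (subset_span ⟨_, h, rfl⟩)
  · simp [parZ_eq_zero j p h]

omit [Fintype σ] [DecidableEq κ] in
theorem exists_parMap_eq [WellFoundedLT ι] {E : σ → ι → (ρ → k) × (κ → k)} {X : Matrix ρ κ k}
    (h : ∀ j, Pos (fun a => e j (.inl a)) (E j) (rowGraph X)) :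
    ∃ p : ParIdx e → k, parX p = X ∧ parMap p = E := by
  classical
  have key : ∀ j a, ∃ z : κ → k, (∀ b, ¬ Prec e j a b → z b = 0) ∧
      E j (e j (.inl a)) - ∑ b, z b • E j (e j (.inr b)) ∈ rowGraph X := by
    intro j a
    obtain ⟨f, hf, hfa⟩ := (h j).exists_reduced a
    have h1 : E j '' {c | c < e j (.inl a) ∧ c ∉ Set.range fun a => e j (.inl a)} ⊆
        (fun b => E j (e j (.inr b))) '' {b | Prec e j a b} := by
      rintro _ ⟨c, ⟨hc, hc'⟩, rfl⟩
      obtain ⟨c, rfl⟩ := (e j).surjective c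
      cases c with
      | inl a' => exact absurd ⟨a', rfl⟩ hc'
      | inr b => exact ⟨b, hc, rfl⟩
    obtain ⟨l, hl, hlf⟩ := (Finsupp.mem_span_image_iff_linearCombination k).1 (span_mono h1 hfa)
    refine ⟨-l, fun b hb => ?_, ?_⟩
    · simpa using Finsupp.notMem_support_iff.1 fun hb' => hb (hl hb')
    · rw [Finsupp.linearCombination_apply, Finsupp.sum_fintype _ _ (by simp)] at hlf
      simpa [hlf] using hf
  choose z hz hzX using key
  let p : ParIdx e → k := parMk X (fun j => fun a => (E j (e j (.inl a))).1)
    (fun j => fun b => (E j (e j (.inr b))).1) (fun j => fun b => (E j (e j (.inr b))).2) z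
  have hZ : ∀ j a, parZ j p a = z j a := fun j a => parZ_parMk _ _ _ _ hz j a
  refine ⟨p, rfl, ?_⟩
  funext j i
  obtain ⟨i, rfl⟩ := (e j).surjective i
  cases i with
  | inr b => rw [parMap_inr]; rfl
  | inl a =>
    have h1 := mem_rowGraph.1 (hzX j a)
    have h2 := parF_eq p j a
    have h3 : ∀ b, parMap p j (e j (.inr b)) = E j (e j (.inr b)) := fun b => by
      rw [parMap_inr]; rfl
    simp only [h3, hZ] at h2
    have h4 : parF j p a = (E j (e j (.inl a)) - ∑ b, z j a b • E j (e j (.inr b))).1 := by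
      have := congrArg Prod.fst h2
      rw [parMap_inl] at this
      exact this
    have hX : parX p = X := rfl
    rw [hX, h4, ← h1] at h2
    exact (sub_left_injective h2).symm


theorem polyMap_coord {ι : Type*} (i : ι) : PolyMap k fun p : ι → k => p i :=
  (LinearMap.proj i : (ι → k) →ₗ[k] k).polyMap

omit [Fintype σ] [Fintype ρ] [Fintype κ] [DecidableEq κ] in
theorem polyMap_parZ (j : σ) (a : ρ) (b : κ) :
    PolyMap k fun p : ParIdx e → k => parZ j p a b := by
  by_cases h : Prec e j a b
  · simp only [parZ, dif_pos h]
    exact polyMap_coord _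
  · simpa only [parZ, dif_neg h] using PolyMap.const 0

omit [Fintype σ] [Fintype κ] [DecidableEq κ] in
theorem polyMap_parG (j : σ) (a : κ) (b : κ) :
    PolyMap k fun p : ParIdx e → k => parG j p a b := by
  simp only [parG, Matrix.sub_apply, Matrix.mul_apply]
  exact (polyMap_coord _).sub (PolyMap.sum _ fun c => (polyMap_coord _).mul (polyMap_coord _))

omit [Fintype σ] [Fintype ρ] [DecidableEq κ] in
theorem polyMap_parF (j : σ) (a : ρ) (b : ρ) :
    PolyMap k fun p : ParIdx e → k => parF j p a b := by
  simp only [parF, Matrix.sub_apply, Matrix.mul_apply]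
  exact (polyMap_coord _).sub (PolyMap.sum _ fun c => (polyMap_parZ _ _ _).mul (polyMap_coord _))

omit [DecidableEq κ] in
theorem polyMap_parMap [Finite ι] : PolyMap k fun p : ParIdx e → k => parMap p := by
  refine PolyMap.pi fun j => PolyMap.pi fun i => ?_
  obtain ⟨i, rfl⟩ := (e j).surjective i
  cases i with
  | inr b =>
    simp only [parMap_inr]
    exact (PolyMap.pi fun c => polyMap_coord _).prodMk (PolyMap.pi fun c => polyMap_coord _)
  | inl a =>
    simp only [parMap_inl]
    refine (PolyMap.pi fun c => polyMap_coord _).prodMk (PolyMap.pi fun c => ?_)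
    simp only [Matrix.add_apply, Matrix.mul_apply]
    exact (PolyMap.sum _ fun c => (polyMap_coord _).mul (polyMap_coord _)).add
      (PolyMap.sum _ fun c => (polyMap_parZ _ _ _).mul (polyMap_parG _ _ _))

omit [DecidableEq κ] in
theorem finrank_parIdx [Fintype ι] (e : σ → ρ ⊕ κ ≃ ι) :
    finrank k (ParIdx e → k) + Nat.card (Blk (Prec e)) =
      finrank k (σ → ι → (ρ → k) × (κ → k)) + Fintype.card ρ * Fintype.card κ := by
  classical
  have h1 : Fintype.card {t : σ × ρ × κ // Prec e t.1 t.2.1 t.2.2} + Nat.card (Blk (Prec e)) =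
      Fintype.card σ * (Fintype.card ρ * Fintype.card κ) := by
    rw [Nat.card_eq_fintype_card, Fintype.card_subtype_compl, ← Fintype.card_prod,
      ← Fintype.card_prod]
    exact Nat.add_sub_cancel' (Fintype.card_subtype_le _)
  have h2 : finrank k (σ → ι → (ρ → k) × (κ → k)) = Fintype.card σ *
      ((Fintype.card ρ + Fintype.card κ) * (Fintype.card ρ + Fintype.card κ)) := by
    rw [Module.finrank_pi_fintype, ]
    simp only [Module.finrank_pi_fintype, Module.finrank_prod, Finset.sum_const, Finset.card_univ,
      Module.finrank_self, smul_eq_mul, mul_one]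
    rcases isEmpty_or_nonempty σ with h | ⟨⟨j⟩⟩
    · simp
    · rw [← Fintype.card_congr (e j), Fintype.card_sum]
  rw [Module.finrank_pi, h2]
  simp only [Fintype.card_sum, Fintype.card_prod]
  linarith

omit [Fintype σ] [Fintype κ] [DecidableEq κ] in
theorem parG_parMk_one (j : σ) (X : Matrix ρ κ k) (Y : σ → Matrix ρ ρ k) (V : σ → Matrix κ κ k)
    (Z : σ → ρ → κ → k) : parG j (parMk X Y 0 V Z : ParIdx e → k) = V j := by
  have : parU j (parMk X Y 0 V Z : ParIdx e → k) = 0 := rfl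
  rw [parG, this, Matrix.zero_mul, sub_zero]
  rfl

section Generators

variable {M n : Type*} [Fintype n] [DecidableEq n] (A : Subalgebra k (M → k)) {G : M → Matrix n n k}

omit [Fintype n] [DecidableEq n] in
theorem Subalgebra.matrix_mul_mem {l m : Type*} [Fintype m] {P : M → Matrix l m k}
    {Q : M → Matrix m n k} (hP : ∀ a b, (fun x => P x a b) ∈ A) (hQ : ∀ a b, (fun x => Q x a b) ∈ A)
    (a : l) (b : n) : (fun x => (P x * Q x) a b) ∈ A := by
  have : (fun x => (P x * Q x) a b) = ∑ c, (fun x => P x a c) * fun x => Q x c b := by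
    funext x; simp [Matrix.mul_apply]
  rw [this]
  exact sum_mem fun c _ => mul_mem (hP _ _) (hQ _ _)

theorem Subalgebra.det_mem (hG : ∀ a b, (fun x => G x a b) ∈ A) : (fun x => (G x).det) ∈ A := by
  have : (fun x => (G x).det) = ∑ w : Equiv.Perm n,
      ((Equiv.Perm.sign w : ℤ) : M → k) * ∏ i, fun x => G x (w i) i := by
    funext x
    simp [Matrix.det_apply', Finset.sum_apply, Finset.prod_apply]
  rw [this]
  exact sum_mem fun w _ => mul_mem (intCast_mem _ _) (prod_mem fun i _ => hG _ _)

theorem Subalgebra.adjugate_mem (hG : ∀ a b, (fun x => G x a b) ∈ A) (a b : n) :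
    (fun x => (G x).adjugate a b) ∈ A := by
  simp only [Matrix.adjugate_apply]
  refine A.det_mem fun c d => ?_
  by_cases h : c = b
  · subst h
    simp only [Matrix.updateRow_self]
    exact A.algebraMap_mem ((Pi.single a 1 : n → k) d)
  · simpa only [Matrix.updateRow_ne h] using hG c d

end Generators

omit [Fintype σ] in
/-- The coordinates of the parameter space are rational functions of the parametrized families and
of the matrix of the subspace. -/
theorem exists_mul_mem_adjoin [Fintype ι] (i : ParIdx e) :
    ∃ D ∈ Algebra.adjoin k
      (Set.range (fun (l : Dual k (σ → ι → (ρ → k) × (κ → k))) (p : ParIdx e → k) => l (parMap p)) ∪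
        Set.range fun (t : ρ × κ) (p : ParIdx e → k) => parX p t.1 t.2),
      D ≠ 0 ∧ D * (fun p => p i) ∈ Algebra.adjoin k
      (Set.range (fun (l : Dual k (σ → ι → (ρ → k) × (κ → k))) (p : ParIdx e → k) => l (parMap p)) ∪
        Set.range fun (t : ρ × κ) (p : ParIdx e → k) => parX p t.1 t.2) := by
  set A := Algebra.adjoin k
      (Set.range (fun (l : Dual k (σ → ι → (ρ → k) × (κ → k))) (p : ParIdx e → k) => l (parMap p)) ∪
        Set.range fun (t : ρ × κ) (p : ParIdx e → k) => parX p t.1 t.2)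
  have hX : ∀ a b, (fun p : ParIdx e → k => parX p a b) ∈ A := fun a b =>
    Algebra.subset_adjoin (.inr ⟨(a, b), rfl⟩)
  have hl : ∀ l : Dual k (σ → ι → (ρ → k) × (κ → k)), (fun p => l (parMap p)) ∈ A := fun l =>
    Algebra.subset_adjoin (.inl ⟨l, rfl⟩)
  have h1 : ∀ j c a, (fun p : ParIdx e → k => (parMap p j c).1 a) ∈ A := fun j c a =>
    hl (LinearMap.proj a ∘ₗ LinearMap.fst k _ _ ∘ₗ LinearMap.proj c ∘ₗ LinearMap.proj j)
  have h2 : ∀ j c a, (fun p : ParIdx e → k => (parMap p j c).2 a) ∈ A := fun j c a =>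
    hl (LinearMap.proj a ∘ₗ LinearMap.snd k _ _ ∘ₗ LinearMap.proj c ∘ₗ LinearMap.proj j)
  have hY : ∀ j a b, (fun p : ParIdx e → k => parY j p a b) ∈ A := fun j a b => by
    simpa only [parMap_inl] using h1 j (e j (.inl a)) b
  have hU : ∀ j a b, (fun p : ParIdx e → k => parU j p a b) ∈ A := fun j a b => by
    simpa only [parMap_inr] using h1 j (e j (.inr a)) b
  have hV : ∀ j a b, (fun p : ParIdx e → k => parV j p a b) ∈ A := fun j a b => by
    simpa only [parMap_inr] using h2 j (e j (.inr a)) b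
  have hone : ∀ f ∈ A, ∃ D ∈ A, D ≠ 0 ∧ D * f ∈ A := fun f hf =>
    ⟨1, one_mem _, one_ne_zero, by simpa⟩
  rcases i with ⟨a, b⟩ | ⟨j, a, b⟩ | ⟨j, a, b⟩ | ⟨j, a, b⟩ | ⟨⟨j, a, b⟩, hab⟩
  · exact hone _ (hX a b)
  · exact hone _ (hY j a b)
  · exact hone _ (hU j a b)
  · exact hone _ (hV j a b)
  · have hG : ∀ c d, (fun p : ParIdx e → k => parG j p c d) ∈ A := fun c d =>
      sub_mem (hV j c d) (A.matrix_mul_mem (hU j) hX c d)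
    refine ⟨_, A.det_mem hG, fun h0 => ?_, ?_⟩
    · have := congrFun h0 (parMk 0 0 0 1 0)
      simp [parG_parMk_one] at this
    · have hW : ∀ c d, (fun p : ParIdx e → k => (parZ j p * parG j p) c d) ∈ A := fun c d => by
        have := sub_mem (h2 j (e j (.inl c)) d) (A.matrix_mul_mem (hY j) hX c d)
        refine (congrArg (· ∈ A) (funext fun p => ?_)).mp this
        simp [parMap_inl]
      have h3 := A.matrix_mul_mem hW (A.adjugate_mem hG) a b
      refine (congrArg (· ∈ A) (funext fun p => ?_)).mp h3
      rw [Matrix.mul_assoc, Matrix.mul_adjugate, Matrix.mul_smul, Matrix.mul_one, Matrix.smul_apply,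
        parZ]
      simp only [dif_pos hab]
      rfl

end Param

/-! ### The fundamental dimension inequality -/

theorem Pos.mono {k V ι ρ : Type*} [Field k] [AddCommGroup V] [Module k V] [LinearOrder ι]
    {I : ρ → ι} {b : ι → V} {S T : Submodule k V} (h : Pos I b S) (hST : S ≤ T) : Pos I b T :=
  fun a => (h a).imp fun _ hf => ⟨hST hf.1, hf.2⟩

/-- If subspaces of given position are dense, then so are the graphs of linear maps. -/
theorem SubDense.frequently_graph {k U Q ι ρ σ : Type*} [Field k] [Infinite k] [AddCommGroup U]
    [Module k U] [AddCommGroup Q] [Module k Q] [FiniteDimensional k U] [FiniteDimensional k Q]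
    [LinearOrder ι] [Fintype ρ] [Finite σ] [Finite ι] (hU : finrank k U = Fintype.card ρ)
    {I : σ → ρ → ι} (h : SubDense k (U × Q) I) :
    ∃ᶠ b in zar k (σ → ι → U × Q), ∃ X : U →ₗ[k] Q, ∀ j, Pos (I j) (b j) X.graph := by
  rw [frequently_zar]
  intro g hg hne
  obtain ⟨b, hb, S, hS, hpos⟩ := frequently_zar.1 h g hg hne
  obtain ⟨w⟩ : Nonempty (S ≃ₗ[k] U) := ⟨LinearEquiv.ofFinrankEq _ _ (by rw [hS, hU])⟩
  obtain ⟨t₀, ht₀⟩ := LinearMap.exists_extend (LinearMap.inl k U Q ∘ₗ w.toLinearMap)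
  let L : (U × Q →ₗ[k] U × Q) → S →ₗ[k] U := fun t => LinearMap.fst k U Q ∘ₗ t ∘ₗ S.subtype
  have hL₀ : Function.Injective (L t₀) := by
    have : L t₀ = w.toLinearMap := by
      simp only [L]
      rw [ht₀]
      ext; simp
    rw [this]
    exact w.injective
  have heval : ∀ v, PolyMap k fun t : U × Q →ₗ[k] U × Q => t v := fun v =>
    (LinearMap.applyₗ v).polyMap
  have hL := eventually_injective (L := L)
    (fun u => (heval u).fst) hL₀
  have hg' : PolyMap k fun t : U × Q →ₗ[k] U × Q => g fun j c => t (b j c) :=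
    hg.comp (PolyMap.pi fun j => PolyMap.pi fun c => heval _)
  obtain ⟨t, ht, htg⟩ := (hL.and (hg'.eventually_ne (x := LinearMap.id) hb)).exists
  have hfin : finrank k S = finrank k U := by rw [hS, hU]
  let w' : S ≃ₗ[k] U := LinearEquiv.ofBijective (L t)
    ⟨ht, (LinearMap.injective_iff_surjective_of_finrank_eq_finrank hfin).1 ht⟩
  refine ⟨_, htg, LinearMap.snd k U Q ∘ₗ t ∘ₗ S.subtype ∘ₗ w'.symm.toLinearMap, fun j =>
    ((hpos j).map t).mono ?_⟩
  rintro _ ⟨v, hv, rfl⟩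
  rw [LinearMap.mem_graph_iff]
  have : w'.symm (t v).1 = ⟨v, hv⟩ := w'.symm_apply_eq.2 rfl
  simp [this]

theorem rowGraph_toMatrixRight {k ρ κ : Type*} [Field k] [Fintype ρ] [DecidableEq ρ]
    (X : (ρ → k) →ₗ[k] (κ → k)) :
    rowGraph (LinearMap.toMatrixRight' X) = X.graph := by
  ext v
  rw [mem_rowGraph, LinearMap.mem_graph_iff]
  have : Matrix.toLinearMapRight' (LinearMap.toMatrixRight' X) v.1 = X v.1 := by simp
  rw [← this]; rfl

section Inequality

variable {k σ ρ τ π κ ι : Type*} [Field k] [Infinite k] [Fintype σ] [Fintype ρ] [Fintype τ] [Fintype π] [Fintype κ] [Fintype ι]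
  [LinearOrder ι] [LinearOrder ρ]

/-- The positions in the larger family. -/
def transEquiv (e : σ → ρ ⊕ κ ≃ ι) (f : σ → τ ⊕ π ≃ ρ) (j : σ) : τ ⊕ (π ⊕ κ) ≃ ι :=
  (Equiv.sumAssoc τ π κ).symm.trans (((f j).sumCongr (Equiv.refl κ)).trans (e j))

omit [Fintype ρ] [Fintype ι] in
theorem card_blk_transEquiv {e : σ → ρ ⊕ κ ≃ ι} (he : ∀ j, StrictMono fun a => e j (.inl a))
    (f : σ → τ ⊕ π ≃ ρ) :
    Nat.card (Blk (Prec f)) + Nat.card (Blk fun j t => Prec e j (f j (.inl t))) ≤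
      Nat.card (Blk (Prec (transEquiv e f))) := by
  rw [← Nat.card_sum]
  refine Nat.card_le_card_of_injective (Sum.elim
    (fun t => ⟨(t.1.1, t.1.2.1, .inl t.1.2.2), fun h => t.2 ((he _).lt_iff_lt.1 h)⟩)
    (fun t => ⟨(t.1.1, t.1.2.1, .inr t.1.2.2), t.2⟩)) ?_
  rintro (⟨⟨j, a, b⟩, h⟩ | ⟨⟨j, a, b⟩, h⟩) (⟨⟨j', a', b'⟩, h'⟩ | ⟨⟨j', a', b'⟩, h'⟩) <;>
    simp [Subtype.ext_iff]

omit [LinearOrder ρ] in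
theorem SubDense.exists_parMap [DecidableEq κ] {e : σ → ρ ⊕ κ ≃ ι}
    (h : SubDense k ((ρ → k) × (κ → k)) fun j a => e j (.inl a))
    {g : (σ → ι → (ρ → k) × (κ → k)) → k} (hg : PolyMap k g) (hne : ∃ y, g y ≠ 0) :
    ∃ p : ParIdx e → k, g (parMap p) ≠ 0 := by
  classical
  obtain ⟨b, hb, X, hX⟩ := frequently_zar.1 (h.frequently_graph (by simp)) g hg hne
  obtain ⟨p, -, hp⟩ := exists_parMap_eq (X := LinearMap.toMatrixRight' X) (E := b) (e := e)
    fun j => by rw [rowGraph_toMatrixRight]; exact hX j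
  exact ⟨p, by rwa [hp]⟩

theorem SubDense.card_blk_le [DecidableEq π] [DecidableEq κ] {e : σ → ρ ⊕ κ ≃ ι} (he : ∀ j, StrictMono fun a => e j (.inl a))
    {f : σ → τ ⊕ π ≃ ρ}
    (hI : SubDense k (((τ → k) × (π → k)) × (κ → k)) fun j a => e j (.inl a))
    (hK : SubDense k ((τ → k) × (π → k)) fun j a => f j (.inl a)) :
    Nat.card (Blk fun j t => Prec e j (f j (.inl t))) ≤ Fintype.card τ * Fintype.card κ := by
  classical
  by_contra! hlt
  obtain ⟨⟨⟨j₀, -⟩, -⟩⟩ : Nonempty (Blk fun j t => Prec e j (f j (.inl t))) :=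
    (Nat.card_pos_iff.1 (Nat.zero_lt_of_lt hlt)).1
  have hρ : finrank k ((τ → k) × (π → k)) = Fintype.card ρ := by
    rw [← Fintype.card_congr (f j₀)]; simp
  obtain ⟨B, hBcard, hB⟩ := (polyMap_parMap (k := k) (e := f)).exists_dominant_extension
    (fun g hg hne => hK.exists_parMap hg hne) (ξ := fun (t : τ × π) (p : ParIdx f → k) => parX p t.1 t.2)
    (fun t => polyMap_coord _) (Pi.basisFun k (ParIdx f)) fun i => by
      obtain ⟨D, hD⟩ := exists_mul_mem_adjoin (k := k) i
      refine ⟨D, hD.1, hD.2.1, ?_⟩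
      have : ((Pi.basisFun k (ParIdx f)).coord i : (ParIdx f → k) → k) = fun p => p i := by
        ext p; simp
      rw [this]
      exact hD.2.2
  let Ψ : (ParIdx (transEquiv e f) → k) →
      (σ → ι → (τ → k) × (π ⊕ κ → k)) × (B → k) :=
    fun p => (parMap p, fun t => parX p t.1.1 (.inl t.1.2))
  have hΨ : PolyMap k Ψ := polyMap_parMap.prodMk (PolyMap.pi fun t => polyMap_coord _)
  have hlt' : finrank k (ParIdx (transEquiv e f) → k) <
      finrank k ((σ → ι → (τ → k) × (π ⊕ κ → k)) × (B → k)) := by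
    have h1 := finrank_parIdx (k := k) f
    have h2 := finrank_parIdx (k := k) (transEquiv e f)
    have h3 := card_blk_transEquiv he f
    rw [Module.finrank_prod, Module.finrank_pi k (ι := B), Fintype.card_coe]
    rw [Fintype.card_sum, mul_add] at h2
    omega
  obtain ⟨P, hP, ⟨⟨E₀, c₀⟩, hP₀⟩, hPΨ⟩ := hΨ.exists_vanishing_of_finrank_lt hlt'
  let Θ : (((τ → k) × (π → k)) × (κ → k)) ≃ₗ[k] (τ → k) × (π ⊕ κ → k) :=
    (LinearEquiv.prodAssoc k _ _ _).trans
      ((LinearEquiv.refl k _).prodCongr (LinearEquiv.sumArrowLequivProdArrow π κ k k).symm)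
  let Q : (σ → ι → ((τ → k) × (π → k)) × (κ → k)) × (B → k) → k :=
    fun x => P (fun j i => Θ (x.1 j i), x.2)
  have hQ : PolyMap k Q := hP.comp <| PolyMap.prodMk (PolyMap.pi fun j => PolyMap.pi fun c =>
    PolyMap.linear_comp Θ.toLinearMap ((PolyMap.apply c).comp ((PolyMap.apply j).comp PolyMap.id'.fst)))
    PolyMap.id'.snd
  obtain ⟨b, hb, X, hX⟩ := frequently_zar.1 (hI.frequently_graph hρ) (fun b => Q (b, c₀))
    (hQ.comp (PolyMap.id'.prodMk (PolyMap.const c₀)))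
    ⟨fun j i => Θ.symm (E₀ j i), by simpa [Q] using hP₀⟩
  choose s hs hsb using fun j => (hX j).exists_reduced
  let θ : ((τ → k) × (π → k)) →ₗ[k] ((τ → k) × (π → k)) × (κ → k) := LinearMap.id.prod X
  have hθ : ∀ j a, θ (s j a).1 = s j a := fun j a =>
    Prod.ext rfl (LinearMap.mem_graph_iff _ _|>.1 (hs j a)).symm
  let fam : (σ → ρ → (τ → k) × (π → k)) → σ → ι → ((τ → k) × (π → k)) × (κ → k) := fun F j =>
    replaceFamily (fun a => e j (.inl a)) (b j) fun a => θ (F j a) + (b j (e j (.inl a)) - s j a)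
  have hfam : PolyMap k fam := PolyMap.pi fun j => PolyMap.pi fun c => by
    refine PolyMap.replaceFamily _ (fun a => ?_) c
    exact (PolyMap.linear_comp θ ((PolyMap.apply a).comp (PolyMap.apply j))).add
      (PolyMap.const _)
  have hfam₀ : fam (fun j a => (s j a).1) = b := by
    funext j
    simp only [fam, hθ, add_sub_cancel]
    exact replaceFamily_self (he j).injective (b j)
  obtain ⟨p, hp⟩ := hB (fun x => Q (fam x.1, x.2))
    (hQ.comp ((hfam.comp PolyMap.id'.fst).prodMk PolyMap.id'.snd))
    ⟨(fun j a => (s j a).1, c₀), by simpa only [hfam₀] using hb⟩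
  let Λ : (τ → k) →ₗ[k] (π ⊕ κ → k) := LinearMap.snd k _ _ ∘ₗ Θ.toLinearMap ∘ₗ θ ∘ₗ
    LinearMap.id.prod (Matrix.vecMulLinear (parX p))
  obtain ⟨p', hp'X, hp'⟩ := exists_parMap_eq (e := transEquiv e f)
    (X := LinearMap.toMatrixRight' Λ) (E := fun j i => Θ (fam (parMap p) j i)) fun j => by
      rw [rowGraph_toMatrixRight]
      have h1 := (pos_parMap p j).replaceFamily (he j) (b j) θ
        (l := fun a => b j (e j (.inl a)) - s j a) fun a => by simpa using neg_mem (hsb j a)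
      refine (h1.map Θ.toLinearMap).mono ?_
      rintro _ ⟨_, ⟨⟨v, w⟩, hv, rfl⟩, rfl⟩
      obtain rfl : w = Matrix.vecMul v (parX p) := mem_rowGraph.1 hv
      rw [LinearMap.mem_graph_iff]
      rfl
  refine hp ?_
  have := hPΨ p'
  simp only [Ψ, hp', hp'X] at this
  refine Eq.trans ?_ this
  simp only [Q]
  congr 2
  funext t
  have h2 : LinearMap.toMatrixRight' Λ t.1.1 (.inl t.1.2) = Λ (Pi.single t.1.1 1) (.inl t.1.2) := rfl
  rw [h2]
  simp [Λ, Θ, θ]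

end Inequality

/-! ### Existence of independent conditions -/

theorem exists_sum_equiv {α β γ : Type*} [Fintype α] [Fintype β] [Fintype γ] {K : α → γ}
    (hK : Function.Injective K) (h : Fintype.card γ = Fintype.card α + Fintype.card β) :
    ∃ f : α ⊕ β ≃ γ, ∀ a, f (.inl a) = K a := by
  classical
  have hc : Fintype.card β = Fintype.card ↑((Set.range K)ᶜ : Set γ) := by
    rw [Fintype.card_compl_set, Set.card_range_of_injective hK]
    omega
  exact ⟨((Equiv.ofInjective K hK).sumCongr (Fintype.equivOfCardEq hc)).trans
    (Equiv.Set.sumCompl (Set.range K)), fun a => by simp⟩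

section Conditions

variable {k σ κ ι : Type*} [Field k] [Infinite k] [Fintype σ] [Fintype κ] [Fintype ι]
  [DecidableEq κ] [LinearOrder ι] {r : ℕ}

theorem SubDense.card_blk_le_mul {e : σ → Fin r ⊕ κ ≃ ι} (he : ∀ j, StrictMono fun a => e j (.inl a))
    (hI : SubDense k ((Fin r → k) × (κ → k)) fun j a => e j (.inl a)) :
    Nat.card (Blk (Prec e)) ≤ r * Fintype.card κ := by
  have h := SubDense.card_blk_le (k := k) (f := fun _ : σ => Equiv.sumEmpty (Fin r) Empty) he
    (hI.equiv (LinearEquiv.ofFinrankEq _ _ (by simp))) ?_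
  · simpa using h
  · refine Filter.Eventually.frequently (Filter.Eventually.of_forall fun b => ⟨⊤, by simp, ?_⟩)
    exact fun j a => ⟨b j a, mem_top, by simp⟩

theorem SubDense.exists_surjective {e : σ → Fin r ⊕ κ ≃ ι} (he : ∀ j, StrictMono fun a => e j (.inl a))
    (hI : SubDense k ((Fin r → k) × (κ → k)) fun j a => e j (.inl a)) :
    ∃ (f : σ → Fin r → Fin r → k) (h : σ → κ → Dual k (κ → k)),
      Function.Surjective (constraintMap (Prec e) f h) := by
  by_contra hns
  obtain ⟨d, K, hK, hKd, hlt⟩ := exists_subDense_of_not_surjective r (Prec e) hns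
  obtain ⟨⟨⟨j₀, -⟩, -⟩⟩ : Nonempty (Blk fun j t => Prec e j (K j t)) :=
    (Nat.card_pos_iff.1 (Nat.zero_lt_of_lt hlt)).1
  have hdr : d ≤ r := by simpa using Fintype.card_le_of_injective _ (hK j₀).injective
  choose f hf using fun j => exists_sum_equiv (β := Fin (r - d)) (hK j).injective (by simp [hdr])
  have h := SubDense.card_blk_le (k := k) (f := f) he
    (hI.equiv (LinearEquiv.ofFinrankEq _ _ (by simp [hdr]))) (by
      simp only [hf]
      exact hKd.equiv (LinearEquiv.ofFinrankEq _ _ (by simp [hdr])))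
  simp only [hf, Fintype.card_fin] at h
  exact absurd h (not_le.2 hlt)

end Conditions

/-! ### Infinitesimal deformations of subspaces of given position -/

section Deformation

/-- The linear functional given by a column of a matrix. -/
def colFunctional {k κ : Type*} [Field k] [Fintype κ] (G : Matrix κ κ k) (b : κ) : Dual k (κ → k) :=
  ∑ c, G c b • LinearMap.proj c

theorem colFunctional_apply {k κ : Type*} [Field k] [Fintype κ] (G : Matrix κ κ k) (b : κ)
    (w : κ → k) : colFunctional G b w = Matrix.vecMul w G b := by
  simp [colFunctional, Matrix.vecMul, dotProduct, mul_comm]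

theorem PolyMap.adjugate {k M κ : Type*} [Field k] [AddCommGroup M] [Module k M] [Fintype κ]
    [DecidableEq κ] {G : M → Matrix κ κ k} (hG : ∀ a b, PolyMap k fun x => G x a b) (a b : κ) :
    PolyMap k fun x => (G x).adjugate a b := by
  simp only [Matrix.adjugate_apply]
  refine PolyMap.det fun c d => ?_
  by_cases h : c = b
  · subst h
    simp only [Matrix.updateRow_self]
    exact PolyMap.const _
  · simpa only [Matrix.updateRow_ne h] using hG c d

theorem PolyMap.colFunctional {k M κ : Type*} [Field k] [AddCommGroup M] [Module k M] [Fintype κ]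
    {G : M → Matrix κ κ k} (hG : ∀ a b, PolyMap k fun x => G x a b) (b : κ) :
    PolyMap k fun x => colFunctional (G x) b :=
  PolyMap.sum _ fun c => (hG c b).smul (PolyMap.const _)

variable {k V σ ρ κ ι : Type*} [Field k] [AddCommGroup V] [Module k V] [LinearOrder ι]

/-- Every homomorphism `S → V` which is compatible modulo `S` with the filtrations defined by the
families `b j` at the positions `I j` maps into `S`. -/
def Rigid (I : σ → ρ → ι) (b : σ → ι → V) (S : Submodule k V) : Prop :=
  ∀ ψ : S →ₗ[k] V, (∀ j a, ∀ v : S, (v : V) ∈ span k (b j '' Set.Iic (I j a)) →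
    ψ v ∈ S ⊔ span k (b j '' Set.Iic (I j a))) → ∀ v, ψ v ∈ S

/-- The linear conditions on an infinitesimal deformation. -/
def defMap [Fintype ρ] [Fintype κ] [DecidableEq κ] {e : σ → ρ ⊕ κ ≃ ι} (p : ParIdx e → k) :
    ((ρ → k) →ₗ[k] (κ → k)) →ₗ[k] (Blk (Prec e) → k) :=
  constraintMap (Prec e) (fun j => parF j p) fun j => colFunctional (parG j p).adjugate

variable [Fintype σ] [Fintype ρ] [Fintype κ] [DecidableEq κ] {e : σ → ρ ⊕ κ ≃ ι}

omit [Fintype σ] in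
theorem rigid_of_injective [WellFoundedLT ι] (p : ParIdx e → k)
    (hp : Function.Injective (defMap p)) :
    Rigid (fun j a => e j (.inl a)) (parMap p) (rowGraph (parX p)) := by
  obtain ⟨S, hS⟩ : ∃ S, S = rowGraph (parX p) := ⟨_, rfl⟩
  rw [← hS]
  intro ψ hψ
  let δ : (ρ → k) × (κ → k) →ₗ[k] (κ → k) :=
    LinearMap.snd k _ _ - Matrix.vecMulLinear (parX p) ∘ₗ LinearMap.fst k _ _
  have hδ : ∀ w, δ w = 0 ↔ w ∈ S := fun w => by
    rw [hS, mem_rowGraph]; exact sub_eq_zero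
  let γ : (ρ → k) →ₗ[k] S := LinearMap.codRestrict S
    (LinearMap.id.prod (Matrix.vecMulLinear (parX p))) fun v => by
      rw [hS]; exact mem_rowGraph.2 rfl
  let φ := δ ∘ₗ ψ ∘ₗ γ
  have hδe : ∀ j b, δ (parMap p j (e j (.inr b))) = parG j p b := fun j b => by
    rw [parMap_inr]
    change parV j p b - Matrix.vecMul (parU j p b) (parX p) = _
    rw [← mul_row]
    rfl
  have hγ : ∀ j a, (γ (parF j p a) : (ρ → k) × (κ → k)) =
    parMap p j (e j (.inl a)) - ∑ b, parZ j p a b • parMap p j (e j (.inr b)) := fun j a =>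
      parF_eq p j a
  have hδl : ∀ j a, δ (parMap p j (e j (.inl a))) = ∑ b, parZ j p a b • parG j p b := by
    intro j a
    have := (hδ _).2 (γ (parF j p a)).2
    rw [hγ, map_sub, map_sum, sub_eq_zero] at this
    simp only [this, map_smul, hδe]
  have hφ : ∀ j a, φ (parF j p a) ∈ span k (parG j p '' {b | Prec e j a b}) := by
    intro j a
    have h1 := hψ j a (γ (parF j p a)) (by
      rw [hγ]
      refine sub_mem (subset_span ⟨_, le_rfl, rfl⟩) (sum_mem fun b _ => ?_)
      by_cases hb : Prec e j a b
      · exact smul_mem _ _ (subset_span ⟨_, le_of_lt hb, rfl⟩)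
      · simp [parZ_eq_zero j p hb])
    have h2 : S ⊔ span k (parMap p j '' Set.Iic (e j (.inl a))) ≤
        (span k (parG j p '' {b | Prec e j a b})).comap δ := by
      refine sup_le (fun w hw => ?_) (span_le.2 ?_)
      · rw [mem_comap, (hδ w).2 hw]
        exact zero_mem _
      · rintro _ ⟨c, hc, rfl⟩
        obtain ⟨c, rfl⟩ := (e j).surjective c
        rw [SetLike.mem_coe, mem_comap]
        cases c with
        | inr b =>
          rw [hδe]
          exact subset_span ⟨b, lt_of_le_of_ne hc (by simp), rfl⟩
        | inl a' =>
          rw [hδl]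
          refine sum_mem fun b _ => ?_
          by_cases hb : Prec e j a' b
          · exact smul_mem _ _ (subset_span ⟨b, lt_of_lt_of_le hb hc, rfl⟩)
          · simp [parZ_eq_zero j p hb]
    exact h2 h1
  have h0 : φ = 0 := by
    refine hp ?_
    rw [map_zero]
    funext ⟨⟨j, a, b⟩, h⟩
    change colFunctional (parG j p).adjugate b (φ (parF j p a)) = 0
    refine LinearMap.mem_ker.1 ((span_le (p := LinearMap.ker (colFunctional _ _))).2 ?_ (hφ j a))
    rintro _ ⟨c, hc, rfl⟩
    have hcb : c ≠ b := by rintro rfl; exact h hc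
    change colFunctional _ _ _ = 0
    rw [colFunctional_apply, ← mul_row, Matrix.mul_adjugate]
    simp [hcb]
  rintro ⟨v, hv⟩
  have : (⟨v, hv⟩ : S) = γ v.1 := Subtype.ext (Prod.ext rfl (mem_rowGraph.1 (hS ▸ hv)))
  rw [← hδ, this]
  exact LinearMap.congr_fun h0 v.1

theorem colFunctional_of (h : κ → Dual k (κ → k)) (b : κ) :
    colFunctional (Matrix.of fun c b => h b (Pi.single c 1)) b = h b := by
  refine LinearMap.pi_ext' fun c => LinearMap.ext_ring ?_
  simp [colFunctional_apply]

variable [Infinite k]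

omit [Fintype σ] [Infinite k] in
theorem polyMap_defMap [Finite σ] (φ : (ρ → k) →ₗ[k] (κ → k)) :
    PolyMap k fun p : ParIdx e → k => defMap p φ :=
  polyMap_constraintMap _ (fun j a => PolyMap.pi fun c => polyMap_parF j a c)
    (fun j b => PolyMap.colFunctional (PolyMap.adjugate fun c d => polyMap_parG j c d) b) φ

omit [LinearOrder ι] in
theorem eventually_det_ne_zero : ∀ᶠ h in zar k (σ → κ → Dual k (κ → k)), ∀ j,
    (Matrix.of fun c b => h j b (Pi.single c 1) : Matrix κ κ k).det ≠ 0 := by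
  rw [Filter.eventually_all]
  intro j
  have hpoly : ∀ c b, PolyMap k fun h : σ → κ → Dual k (κ → k) => h j b (Pi.single c 1) := fun c b =>
    PolyMap.linear_comp (LinearMap.applyₗ (Pi.single c 1 : κ → k))
      (f := fun h : σ → κ → Dual k (κ → k) => h j b) ((PolyMap.apply b).comp (PolyMap.apply j))
  refine PolyMap.eventually_ne (x := fun _ b => LinearMap.proj b) (PolyMap.det hpoly) ?_
  have : (Matrix.of fun c b => (LinearMap.proj b : (κ → k) →ₗ[k] k) (Pi.single c 1) :
      Matrix κ κ k) = 1 := by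
    ext c b
    simp [Matrix.one_apply, Pi.single_apply, eq_comm]
  rw [this, Matrix.det_one]
  exact one_ne_zero

omit [LinearOrder ι] [Fintype σ] [Fintype ρ] [DecidableEq κ] in
theorem eventually_injective_constraintMap [Finite σ] [Finite ρ] {R : σ → ρ → κ → Prop}
    {f : σ → ρ → ρ → k} {h : σ → κ → Dual k (κ → k)}
    (hfh : Function.Injective (constraintMap R f h)) :
    ∀ᶠ h' in zar k (σ → κ → Dual k (κ → k)), Function.Injective (constraintMap R f h') := by
  have hL : ∀ φ, PolyMap k fun h' : σ → κ → Dual k (κ → k) => constraintMap R f h' φ := fun φ =>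
    PolyMap.pi fun t => PolyMap.linear_comp (LinearMap.applyₗ (φ (f t.1.1 t.1.2.1)))
      ((PolyMap.apply t.1.2.2).comp (PolyMap.apply t.1.1))
  have := Fintype.ofFinite ρ
  exact eventually_injective hL hfh

theorem eventually_injective_defMap
    (hcard : Nat.card (Blk (Prec e)) = Fintype.card ρ * Fintype.card κ)
    {f : σ → ρ → ρ → k} {h : σ → κ → Dual k (κ → k)}
    (hfh : Function.Surjective (constraintMap (Prec e) f h)) :
    ∀ᶠ p in zar k (ParIdx e → k), Function.Injective (defMap p) := by
  have hfin : finrank k ((ρ → k) →ₗ[k] (κ → k)) = finrank k (Blk (Prec e) → k) := by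
    classical
    rw [Module.finrank_pi, ← Nat.card_eq_fintype_card, hcard, Module.finrank_linearMap]
    simp
  have h1 := eventually_injective_constraintMap
    ((LinearMap.injective_iff_surjective_of_finrank_eq_finrank hfin).2 hfh)
  obtain ⟨h', hinj, hdet⟩ := (h1.and eventually_det_ne_zero).exists
  let H : σ → Matrix κ κ k := fun j => Matrix.of fun c b => h' j b (Pi.single c 1)
  have hH : ∀ j, (H j)⁻¹ * H j = 1 := fun j =>
    Matrix.nonsing_inv_mul _ (isUnit_iff_ne_zero.2 (hdet j))
  have hadj : ∀ j, ((H j)⁻¹).adjugate = ((H j)⁻¹).det • H j := fun j => by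
    rw [← Matrix.mul_one ((H j)⁻¹).adjugate, ← hH j, ← Matrix.mul_assoc, Matrix.adjugate_mul,
      Matrix.smul_mul, Matrix.one_mul]
  have hdet' : ∀ j, ((H j)⁻¹).det ≠ 0 := fun j h0 => by
    have := congrArg Matrix.det (hH j)
    rw [Matrix.det_mul, h0, zero_mul, Matrix.det_one] at this
    exact zero_ne_one this
  refine eventually_injective (L := fun p : ParIdx e → k => defMap p)
    (x₀ := parMk 0 f 0 (fun j => (H j)⁻¹) 0)
    polyMap_defMap ?_
  refine (injective_iff_map_eq_zero _).2 fun φ hφ => (injective_iff_map_eq_zero _).1 hinj φ ?_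
  funext t
  have ht := congrFun hφ t
  have hf : parF t.1.1 (parMk 0 f 0 (fun j => (H j)⁻¹) 0 : ParIdx e → k) = f t.1.1 := by
    have h0 : parU t.1.1 (parMk 0 f 0 (fun j => (H j)⁻¹) 0 : ParIdx e → k) = 0 := rfl
    rw [parF, h0, Matrix.mul_zero, sub_zero]
    rfl
  have hG : parG t.1.1 (parMk 0 f 0 (fun j => (H j)⁻¹) 0 : ParIdx e → k) = (H t.1.1)⁻¹ :=
    parG_parMk_one _ _ _ _ _
  have hc : colFunctional (((H t.1.1)⁻¹).det • H t.1.1) t.1.2.2 =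
      ((H t.1.1)⁻¹).det • h' t.1.1 t.1.2.2 := by
    rw [← colFunctional_of (h' t.1.1)]
    simp only [colFunctional, Matrix.smul_apply, Finset.smul_sum, smul_assoc]
    rfl
  change colFunctional (parG t.1.1 _).adjugate t.1.2.2 (φ (parF t.1.1 _ t.1.2.1)) = 0 at ht
  generalize (parMk 0 f 0 (fun j => (H j)⁻¹) 0 : ParIdx e → k) = p at hf hG ht
  rw [hG, hf, hadj, hc, LinearMap.smul_apply, smul_eq_mul] at ht
  exact (mul_eq_zero.1 ht).resolve_left (hdet' _)

end Deformation

section Charts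

theorem finrank_rowGraph {k ρ κ : Type*} [Field k] [Fintype ρ] (X : Matrix ρ κ k) :
    finrank k (rowGraph X) = Fintype.card ρ := by
  rw [rowGraph, LinearMap.graph_eq_range_prod, LinearMap.finrank_range_of_inj, finrank_fintype_fun_eq_card]
  exact fun v w h => congrArg Prod.fst h

variable {k σ κ ι : Type*} [Field k] [Infinite k] [Fintype σ] [Fintype κ] [Fintype ι]
  [DecidableEq κ] [LinearOrder ι] {r : ℕ}

theorem eventually_rigid_rowGraph {e : σ → Fin r ⊕ κ ≃ ι}
    (he : ∀ j, StrictMono fun a => e j (.inl a))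
    (hcard : Nat.card (Blk (Prec e)) = r * Fintype.card κ) :
    ∀ᶠ E in zar k (σ → ι → (Fin r → k) × (κ → k)),
      {X | ∀ j, Pos (fun a => e j (.inl a)) (E j) (rowGraph X)}.Finite ∧
      ∀ X, (∀ j, Pos (fun a => e j (.inl a)) (E j) (rowGraph X)) →
        Rigid (fun j a => e j (.inl a)) E (rowGraph X) := by
  by_cases hI : SubDense k ((Fin r → k) × (κ → k)) fun j a => e j (.inl a)
  · obtain ⟨f, h, hfh⟩ := hI.exists_surjective he
    obtain ⟨u, hu, hu0, hinj⟩ := eventually_zar.1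
      (eventually_injective_defMap (by simpa using hcard) hfh)
    have hdim : finrank k (ParIdx e → k) = finrank k (σ → ι → (Fin r → k) × (κ → k)) := by
      have := finrank_parIdx (k := k) e
      rw [hcard, Fintype.card_fin] at this
      omega
    have h1 := polyMap_parMap.eventually_fiber_ne_zero hdim hu hu0
    have h2 : ∀ᶠ E in zar k (σ → ι → (Fin r → k) × (κ → k)), ∀ a b,
        ((fun p : ParIdx e → k => parX p a b) '' {p | parMap p = E}).Finite := by
      simp only [Filter.eventually_all]
      exact fun a b => polyMap_parMap.eventually_fiber_finite hdim (polyMap_coord _)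
    filter_upwards [h1, h2] with E hE1 hE2
    refine ⟨?_, fun X hX => ?_⟩
    · refine (Set.Finite.pi' fun a => Set.Finite.pi' fun b => hE2 a b).subset fun X hX a b => ?_
      obtain ⟨p, rfl, hp⟩ := exists_parMap_eq hX
      exact ⟨p, hp, rfl⟩
    · obtain ⟨p, rfl, rfl⟩ := exists_parMap_eq hX
      exact rigid_of_injective p (hinj p (hE1 p rfl))
  · filter_upwards [Filter.not_frequently.1 hI] with E hE
    have hno : ∀ X, ¬ ∀ j, Pos (fun a => e j (.inl a)) (E j) (rowGraph X) := fun X hX =>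
      hE ⟨rowGraph X, finrank_rowGraph X, hX⟩
    exact ⟨by simp [hno], fun X hX => (hno X hX).elim⟩

end Charts

section Transport

variable {k V V' σ ρ κ ι : Type*} [Field k] [AddCommGroup V] [Module k V] [AddCommGroup V']
  [Module k V'] [LinearOrder ι]

theorem Rigid.of_map {I : σ → ρ → ι} {b : σ → ι → V} {S : Submodule k V} (e : V ≃ₗ[k] V')
    (h : Rigid I (fun j c => e (b j c)) (S.map e.toLinearMap)) : Rigid I b S := by
  intro ψ hψ v
  have hmap : ∀ (j : σ) (a : ρ), span k ((fun c => e (b j c)) '' Set.Iic (I j a)) =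
      (span k (b j '' Set.Iic (I j a))).map e.toLinearMap := fun j a => by
    rw [map_span, Set.image_image]
    rfl
  have := h (e.toLinearMap ∘ₗ ψ ∘ₗ (e.submoduleMap S).symm.toLinearMap) (fun j a w hw => by
    obtain ⟨v, rfl⟩ := (e.submoduleMap S).surjective w
    rw [hmap] at hw ⊢
    rw [← Submodule.map_sup]
    refine mem_map_of_mem ?_
    rw [LinearMap.comp_apply, LinearEquiv.coe_coe, LinearEquiv.symm_apply_apply]
    obtain ⟨v', hv', hv⟩ := hw
    obtain rfl : v' = v := e.injective hv
    exact hψ j a v hv') (e.submoduleMap S v)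
  obtain ⟨w, hw, hwv⟩ := this
  simp only [LinearMap.comp_apply, LinearEquiv.coe_coe, LinearEquiv.symm_apply_apply] at hwv
  rwa [← e.injective hwv]

end Transport

section Chart

variable {k W ρ κ ι : Type*} [Field k] [AddCommGroup W] [Module k W]

/-- The coordinates of `W` given by a basis whose indices are split into two blocks. -/
def splitChart [Finite ι] (b : Basis ι k W) (π : ρ ⊕ κ ≃ ι) : W ≃ₗ[k] (ρ → k) × (κ → k) :=
  b.equivFun.trans ((LinearEquiv.funCongrLeft k k π).trans
    (LinearEquiv.sumArrowLequivProdArrow ρ κ k k))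

theorem splitChart_fst [Finite ι] (b : Basis ι k W) (π : ρ ⊕ κ ≃ ι) (w : W) (a : ρ) :
    (splitChart b π w).1 a = b.coord (π (.inl a)) w := by
  simp [splitChart, LinearEquiv.sumArrowLequivProdArrow, LinearMap.funLeft]

theorem exists_splitChart_map_eq [FiniteDimensional k W] {n r : ℕ} [Fintype κ]
    (b : Basis (Fin n) k W) (hn : n = r + Fintype.card κ) {S : Submodule k W}
    (hS : finrank k S = r) :
    ∃ (π : Fin r ⊕ κ ≃ Fin n) (X : Matrix (Fin r) κ k),
      S.map (splitChart b π).toLinearMap = rowGraph X := by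
  classical
  subst hS
  obtain ⟨K, hK, hpos, -⟩ := exists_pos b.linearIndependent b.span_eq S
  obtain ⟨π, hπ⟩ := exists_sum_equiv (β := κ) hK.injective (by simpa using hn)
  choose f hfS hf using hpos.exists_reduced
  have hfst : ∀ a, (splitChart b π (f a)).1 = Pi.single a 1 := by
    intro a
    funext a'
    have h0 : f a - b (K a) ∈ LinearMap.ker (b.coord (K a')) := by
      refine (span_le (p := LinearMap.ker (b.coord (K a')))).2 ?_ (hf a)
      rintro _ ⟨c, ⟨-, hc⟩, rfl⟩
      have : c ≠ K a' := fun h => hc ⟨a', h.symm⟩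
      simp [this]
    rw [LinearMap.mem_ker, map_sub, sub_eq_zero] at h0
    rw [splitChart_fst, hπ, h0, Basis.coord_apply, Basis.repr_self, Finsupp.single_apply,
      Pi.single_apply]
    simp [hK.injective.eq_iff, eq_comm]
  refine ⟨π, Matrix.of fun a => (splitChart b π (f a)).2, (eq_of_le_of_finrank_eq ?_ ?_).symm⟩
  · intro w hw
    have hw' : w = ∑ a, w.1 a • splitChart b π (f a) := by
      refine Prod.ext ?_ ?_
      · simp only [Prod.fst_sum, Prod.smul_fst, hfst]
        funext a
        simp [Pi.single_apply]
      · rw [mem_rowGraph.1 hw, Prod.snd_sum]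
        funext c
        simp [Matrix.vecMul, dotProduct]
    rw [hw']
    exact sum_mem fun a _ => smul_mem _ _ (mem_map_of_mem (hfS a))
  · rw [finrank_rowGraph, LinearEquiv.finrank_map_eq, Fintype.card_fin]

end Chart

section Generic

variable {k W σ κ ι : Type*} [Field k] [Infinite k] [AddCommGroup W] [Module k W]
  [FiniteDimensional k W] [Fintype σ] [Fintype κ] [Fintype ι] [LinearOrder ι] {r : ℕ}

/-- When the conditions on the position have total codimension `r * card κ`, there are, for generic
families, finitely many subspaces of this position, and all of them are rigid. -/
theorem eventually_rigid (hW : finrank k W = r + Fintype.card κ) {e : σ → Fin r ⊕ κ ≃ ι}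
    (he : ∀ j, StrictMono fun a => e j (.inl a))
    (hcard : Nat.card (Blk (Prec e)) = r * Fintype.card κ) :
    ∀ᶠ b in zar k (σ → ι → W),
      {S : Submodule k W | finrank k S = r ∧ ∀ j, Pos (fun a => e j (.inl a)) (b j) S}.Finite ∧
      ∀ S : Submodule k W, finrank k S = r → (∀ j, Pos (fun a => e j (.inl a)) (b j) S) →
        Rigid (fun j a => e j (.inl a)) b S := by
  classical
  let b₀ := finBasis k W
  have h : ∀ π : Fin r ⊕ κ ≃ Fin (finrank k W), ∀ᶠ b in zar k (σ → ι → W),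
      {X | ∀ j, Pos (fun a => e j (.inl a)) (fun c => splitChart b₀ π (b j c))
        (rowGraph X)}.Finite ∧
      ∀ X, (∀ j, Pos (fun a => e j (.inl a)) (fun c => splitChart b₀ π (b j c)) (rowGraph X)) →
        Rigid (fun j a => e j (.inl a)) (fun j c => splitChart b₀ π (b j c)) (rowGraph X) :=
    fun π => (tendsto_zar_linearEquiv (LinearEquiv.piCongrRight fun _ =>
      LinearEquiv.piCongrRight fun _ => splitChart b₀ π)).eventually
      (eventually_rigid_rowGraph he hcard)
  filter_upwards [Filter.eventually_all.2 h] with b hb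
  refine ⟨?_, fun S hS hpos => ?_⟩
  · refine (Set.finite_iUnion fun π => (hb π).1.image fun X =>
      (rowGraph X).comap (splitChart b₀ π).toLinearMap).subset fun S hS => ?_
    obtain ⟨π, X, hX⟩ := exists_splitChart_map_eq b₀ hW hS.1
    refine Set.mem_iUnion.2 ⟨π, X, fun j => ?_, ?_⟩
    · rw [← hX]
      exact (hS.2 j).map _
    · simp only [← hX]
      exact comap_map_eq_of_injective (splitChart b₀ π).injective S
  · obtain ⟨π, X, hX⟩ := exists_splitChart_map_eq b₀ hW hS
    refine Rigid.of_map (splitChart b₀ π) ?_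
    rw [hX]
    refine (hb π).2 X fun j => ?_
    rw [← hX]
    exact (hpos j).map _

/-- When the conditions on the position have total codimension larger than `r * card κ`, no subspace
satisfies them for generic families. -/
theorem eventually_not_pos (hW : finrank k W = r + Fintype.card κ) {e : σ → Fin r ⊕ κ ≃ ι}
    (he : ∀ j, StrictMono fun a => e j (.inl a))
    (hcard : r * Fintype.card κ < Nat.card (Blk (Prec e))) :
    ∀ᶠ b in zar k (σ → ι → W), ∀ S : Submodule k W, finrank k S = r →
      ¬ ∀ j, Pos (fun a => e j (.inl a)) (b j) S := by
  classical
  by_contra hn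
  have hI : SubDense k W fun j a => e j (.inl a) := by
    refine (Filter.not_eventually.1 hn).mono fun b hb => ?_
    push Not at hb
    simpa using hb
  exact hcard.not_ge ((hI.equiv (LinearEquiv.ofFinrankEq W ((Fin r → k) × (κ → k))
    (by simpa using hW))).card_blk_le_mul he)

end Generic

section Count

/-- The total number of conditions is the sum of the codimensions. -/
theorem card_blk_prec {σ κ : Type*} [Fintype σ] [Fintype κ] {n r : ℕ} {e : σ → Fin r ⊕ κ ≃ Fin n}
    (he : ∀ j, StrictMono fun a => e j (.inl a)) :
    (Nat.card (Blk (Prec e)) : ℤ) = ∑ j, ∑ a : Fin r, ((n : ℤ) - r + a - (e j (.inl a) : ℕ)) := by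
  classical
  have hcount : ∀ j a, (Fintype.card {b : κ // ¬ Prec e j a b} : ℤ) =
      (n : ℤ) - r + a - (e j (.inl a) : ℕ) := by
    intro j a
    have h1 : Fintype.card {c : Fin r ⊕ κ // e j (.inl a) < e j c} = n - 1 - e j (.inl a) := by
      rw [Fintype.card_congr ((e j).subtypeEquiv (q := fun d => e j (.inl a) < d) fun _ => Iff.rfl),
        Fintype.card_subtype]
      simp [Finset.filter_lt_eq_Ioi]
    have h2 : Fintype.card {c : Fin r ⊕ κ // e j (.inl a) < e j c} =
        Fintype.card {a' : Fin r // a < a'} + Fintype.card {b : κ // ¬ Prec e j a b} := by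
      rw [Fintype.card_congr (Equiv.subtypeSum), Fintype.card_sum]
      congr 1
      · exact Fintype.card_congr (Equiv.subtypeEquivRight fun a' => (he j).lt_iff_lt)
      · refine Fintype.card_congr (Equiv.subtypeEquivRight fun b => ?_)
        rw [Prec, not_lt]
        exact ⟨le_of_lt, fun h => lt_of_le_of_ne h (by simp)⟩
    have h3 : Fintype.card {a' : Fin r // a < a'} = r - 1 - a := by
      rw [Fintype.card_subtype]
      simp [Finset.filter_lt_eq_Ioi]
    have := (e j (.inl a)).isLt
    have := a.isLt
    omega
  have : Nat.card (Blk (Prec e)) = ∑ j, ∑ a, Fintype.card {b : κ // ¬ Prec e j a b} := by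
    rw [Nat.card_congr (show Blk (Prec e) ≃ Σ j, Σ a, {b : κ // ¬ Prec e j a b} from
      { toFun := fun t => ⟨t.1.1, t.1.2.1, t.1.2.2, t.2⟩
        invFun := fun t => ⟨(t.1, t.2.1, t.2.2.1), t.2.2.2⟩
        left_inv := fun _ => rfl
        right_inv := fun _ => rfl })]
    simp
  rw [this]
  push_cast
  exact Finset.sum_congr rfl fun j _ => Finset.sum_congr rfl fun a _ => hcount j a

end Count

section Position

theorem exists_pos_of_finrank {k V : Type*} [Field k] [AddCommGroup V] [Module k V] {n r : ℕ}
    {b : Fin n → V} (hb : LinearIndependent k b) (hspan : span k (Set.range b) = ⊤)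
    {S : Submodule k V} (hS : finrank k S = r) :
    ∃ K : Fin r → Fin n, StrictMono K ∧ Pos K b S ∧
      ∀ m : ℕ, finrank k ↥(S ⊓ span k (b '' {a | (a : ℕ) < m})) =
        Fintype.card {t // (K t : ℕ) < m} := by
  subst hS
  exact exists_pos hb hspan S

theorem le_of_add_one_le_card {n r : ℕ} {K : Fin r → Fin n} (hK : StrictMono K) {a : Fin r} {m : ℕ}
    (h : (a : ℕ) + 1 ≤ Fintype.card {t // (K t : ℕ) < m + 1}) : (K a : ℕ) ≤ m := by
  by_contra! hlt
  have : Fintype.card {t // (K t : ℕ) < m + 1} ≤ Fintype.card {t : Fin r // t < a} := by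
    refine Fintype.card_subtype_mono _ _ fun t ht => hK.lt_iff_lt.1 ?_
    exact Fin.lt_def.2 (by omega)
  rw [Fintype.card_subtype (fun t : Fin r => t < a), Finset.filter_gt_eq_Iio,
    Fin.card_Iio] at this
  omega

theorem StrictMono.card_lt_add_one {n r : ℕ} {K : Fin r → Fin n} (hK : StrictMono K) (a : Fin r) :
    Fintype.card {t // (K t : ℕ) < (K a : ℕ) + 1} = a + 1 := by
  rw [Fintype.card_congr (Equiv.subtypeEquivRight (q := fun t : Fin r => t ≤ a) fun t => by
    rw [Nat.lt_succ_iff, ← Fin.le_def, hK.le_iff_le]), Fintype.card_subtype]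
  simp [Finset.filter_ge_eq_Iic]

variable {k : Type} {W : Type} [Field k] [Infinite k] [AddCommGroup W] [Module k W]
  [FiniteDimensional k W] {n r s : ℕ}

theorem eventually_varMem (hs : 0 < s) (hW : finrank k W = n) (hr : r ≤ n) {I : Fin s → Fin r → Fin n}
    (hI : ∀ j, StrictMono (I j))
    (h0 : (r : ℤ) * ((n : ℤ) - (r : ℤ)) - ∑ j, codimZ n r (I j) = 0) :
    ∀ᶠ b in zar k (Fin s → Fin n → W), (∀ j, LinearIndependent k (b j)) →
      {V | ∀ j, varMem (I j) (spanFlag k (b j)) V}.Finite ∧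
      ∀ V, (∀ j, varMem (I j) (spanFlag k (b j)) V) → Rigid I b V ∧ ∀ j a,
        finrank k ↥(V ⊓ spanFlag k (b j) (I j a + 1)) = a + 1 := by
  have hn : finrank k W = r + Fintype.card (Fin (n - r)) := by simp; omega
  have hsplit : ∀ J : Fin s → Fin r → Fin n, (∀ j, StrictMono (J j)) →
      ∃ e : Fin s → Fin r ⊕ Fin (n - r) ≃ Fin n, ∀ j a, e j (.inl a) = J j a := fun J hJ => by
    choose e he using fun j => exists_sum_equiv (β := Fin (n - r)) (hJ j).injective (by simp; omega)
    exact ⟨e, he⟩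
  have h1 : ∀ᶠ b in zar k (Fin s → Fin n → W),
      {S : Submodule k W | finrank k S = r ∧ ∀ j, Pos (I j) (b j) S}.Finite ∧
      ∀ S : Submodule k W, finrank k S = r → (∀ j, Pos (I j) (b j) S) → Rigid I b S := by
    obtain ⟨e, he⟩ := hsplit I hI
    have hIe : I = fun j a => e j (.inl a) := by simp only [he]
    subst hIe
    refine eventually_rigid hn hI ?_
    zify
    rw [card_blk_prec hI]
    simp only [codimZ] at h0
    rw [Fintype.card_fin, Nat.cast_sub hr]
    linarith
  have h2 : ∀ᶠ b in zar k (Fin s → Fin n → W), ∀ J : Fin s → Fin r → Fin n,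
      (∀ j, StrictMono (J j)) → (∀ j a, J j a ≤ I j a) → J ≠ I →
      ∀ S : Submodule k W, finrank k S = r → ¬ ∀ j, Pos (J j) (b j) S := by
    simp only [Filter.eventually_all]
    intro J hJ hle hne
    obtain ⟨e, he⟩ := hsplit J hJ
    have hJe : J = fun j a => e j (.inl a) := by simp only [he]
    subst hJe
    refine eventually_not_pos hn hJ ?_
    zify
    rw [card_blk_prec hJ, Fintype.card_fin, Nat.cast_sub hr]
    have hlt : ∑ j, codimZ n r (I j) <
        ∑ j, ∑ a : Fin r, ((n : ℤ) - r + a - (e j (.inl a) : ℕ)) := by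
      simp only [codimZ]
      obtain ⟨j, hj⟩ := Function.ne_iff.1 hne
      obtain ⟨a, ha⟩ := Function.ne_iff.1 hj
      have hle' : ∀ j a, ((e j (.inl a) : ℕ) : ℤ) ≤ (I j a : ℕ) := fun j a => by
        exact_mod_cast hle j a
      have hlt' : ((e j (.inl a) : ℕ) : ℤ) < (I j a : ℕ) := by
        exact_mod_cast lt_of_le_of_ne (hle j a) ha
      refine Finset.sum_lt_sum (fun j _ => Finset.sum_le_sum fun a _ => ?_)
        ⟨j, Finset.mem_univ _, Finset.sum_lt_sum (fun a _ => ?_) ⟨a, Finset.mem_univ _, ?_⟩⟩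
      · linarith [hle' j a]
      · linarith [hle' j a]
      · linarith
    linarith
  filter_upwards [h1, h2] with b hb1 hb2 hli
  have hspan : ∀ j, span k (Set.range (b j)) = ⊤ := fun j =>
    (hli j).span_eq_top_of_card_eq_finrank' (by simp [hW])
  have key : ∀ V, (∀ j, varMem (I j) (spanFlag k (b j)) V) → finrank k V = r ∧
      ∀ j, Pos (I j) (b j) V ∧ ∀ m : ℕ, finrank k ↥(V ⊓ spanFlag k (b j) m) =
        Fintype.card {t // (I j t : ℕ) < m} := by
    intro V hV
    have hVr := (hV ⟨0, hs⟩).1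
    choose K hK hpos hcard using fun j => exists_pos_of_finrank (hli j) (hspan j) hVr
    have hKI : K = I := by
      by_contra hne
      refine hb2 K hK (fun j a => Fin.le_def.2 (le_of_add_one_le_card (hK j) ?_)) hne V hVr hpos
      rw [← hcard]
      exact (hV j).2 a
    subst hKI
    exact ⟨hVr, fun j => ⟨hpos j, hcard j⟩⟩
  refine ⟨hb1.1.subset fun V hV => ⟨(key V hV).1, fun j => ((key V hV).2 j).1⟩, fun V hV =>
    ⟨hb1.2 V (key V hV).1 fun j => ((key V hV).2 j).1, fun j a => ?_⟩⟩
  rw [((key V hV).2 j).2, (hI j).card_lt_add_one]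

end Position

section Tangent

variable {k M : Type*} [Field k] [AddCommGroup M] [Module k M]

/-- The restriction of a polynomial function to the line through `x` in the direction `ψ`. -/
def lineRestrict (x ψ : M) : MvPolynomial (Dual k M) k →ₐ[k] Polynomial k :=
  MvPolynomial.aeval fun l : Dual k M => Polynomial.C (l x) + Polynomial.X * Polynomial.C (l ψ)

theorem lineRestrict_X (x ψ : M) (l : Dual k M) : lineRestrict x ψ (MvPolynomial.X l) =
    Polynomial.C (l x) + Polynomial.X * Polynomial.C (l ψ) := by
  simp [lineRestrict]

theorem eval_zero_lineRestrict (x ψ : M) (p : MvPolynomial (Dual k M) k) :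
    (lineRestrict x ψ p).eval 0 = mEval k x p := by
  induction p using MvPolynomial.induction_on with
  | C a => simp [lineRestrict, mEval]
  | add p q hp hq => simp only [map_add, Polynomial.eval_add, hp, hq, mEval]
  | mul_X p l hp =>
    simp only [map_mul, Polynomial.eval_mul, hp, lineRestrict_X]
    simp [mEval]

theorem derivative_lineRestrict (x ψ : M) (p : MvPolynomial (Dual k M) k) :
    Polynomial.derivative (lineRestrict x ψ p) =
      lineRestrict x ψ (MvPolynomial.mkDerivation k (fun l : Dual k M => MvPolynomial.C (l ψ)) p) := by
  induction p using MvPolynomial.induction_on with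
  | C a => simp [lineRestrict]
  | add p q hp hq => simp only [map_add, hp, hq]
  | mul_X p l hp =>
    simp only [map_mul, Polynomial.derivative_mul, hp, lineRestrict_X, Derivation.leibniz,
      MvPolynomial.mkDerivation_X, smul_eq_mul, map_add, Polynomial.derivative_C,
      Polynomial.derivative_X]
    simp [lineRestrict]
    ring

theorem sum_pderiv_apply (x ψ : M) (p : MvPolynomial (Dual k M) k) :
    (∑ l ∈ p.vars, mEval k x (MvPolynomial.pderiv l p) • l) ψ =
      (Polynomial.derivative (lineRestrict x ψ p)).eval 0 := by
  classical
  rw [derivative_lineRestrict, eval_zero_lineRestrict]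
  have h := MvPolynomial.derivation_eq_of_forall_mem_vars (f := p)
    (D₁ := ∑ l ∈ p.vars, (MvPolynomial.C (l ψ) : MvPolynomial (Dual k M) k) • MvPolynomial.pderiv l)
    (D₂ := MvPolynomial.mkDerivation k (fun l : Dual k M => MvPolynomial.C (l ψ))) (fun i hi => by
      rw [MvPolynomial.mkDerivation_X, ← Derivation.coeFnAddMonoidHom_apply, map_sum,
        Finset.sum_apply, Finset.sum_eq_single i]
      · simp
      · intro l _ hl
        simp [MvPolynomial.pderiv_X_of_ne hl.symm]
      · exact fun h => (h hi).elim)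
  rw [← h, ← Derivation.coeFnAddMonoidHom_apply, map_sum, Finset.sum_apply]
  simp [mEval, mul_comm]

theorem mem_mTangent {A : Set M} {x ψ : M} : ψ ∈ mTangent k A x ↔
    ∀ p : MvPolynomial (Dual k M) k, (∀ a ∈ A, mEval k a p = 0) →
      (Polynomial.derivative (lineRestrict x ψ p)).eval 0 = 0 := by
  simp only [mTangent, mem_iInf, LinearMap.mem_ker, Set.mem_ofPred_eq, sum_pderiv_apply]

/-- A determinant vanishing on `A` whose value at `0` is of corank one gives a linear condition on
tangent vectors. -/
theorem apply_eq_zero_of_det_eq_zero {τ : Type*} [Fintype τ] [DecidableEq τ] {A : Set M} {ψ : M}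
    (hψ : ψ ∈ mTangent k A 0) (l : Unit ⊕ τ → Unit ⊕ τ → Dual k M)
    (hA : ∀ a ∈ A, (Matrix.fromBlocks 0 0 0 1 + Matrix.of fun i j => l i j a).det = 0) :
    l (.inl ()) (.inl ()) ψ = 0 := by
  let D : Matrix (Unit ⊕ τ) (Unit ⊕ τ) k := Matrix.fromBlocks 0 0 0 1
  let N : Matrix (Unit ⊕ τ) (Unit ⊕ τ) (MvPolynomial (Dual k M) k) :=
    Matrix.of fun i j => MvPolynomial.C (D i j) + MvPolynomial.X (l i j)
  have hN : ∀ a, mEval k a N.det = (D + Matrix.of fun i j => l i j a).det := by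
    intro a
    rw [mEval, RingHom.map_det]
    congr 1
    ext i j
    simp [N]
  have h := mem_mTangent.1 hψ N.det fun a ha => (hN a).trans (hA a ha)
  let G : Matrix (Unit ⊕ τ) (Unit ⊕ τ) (Polynomial k) := Matrix.of fun i j =>
    Sum.elim (fun _ => Polynomial.C (l i j ψ))
      (fun _ => Polynomial.C (D i j) + Polynomial.X * Polynomial.C (l i j ψ)) i
  have hG : lineRestrict 0 ψ N.det = Polynomial.X * G.det := by
    have := Matrix.det_mul_column (Sum.elim (fun _ : Unit => Polynomial.X) fun _ : τ => 1) G
    simp only [Fintype.prod_sum_type, Finset.univ_unique, Sum.elim_inl, Finset.prod_const,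
      Finset.card_singleton, pow_one, Sum.elim_inr, one_pow, mul_one] at this
    rw [AlgHom.map_det, ← this]
    congr 1
    ext1 (i | i) j <;> simp only [AlgHom.mapMatrix_apply, Matrix.map_apply, N, G, Matrix.of_apply,
      map_add, lineRestrict_X, Sum.elim_inl, Sum.elim_inr, one_mul]
    · cases j <;> simp [D]
    · simp [lineRestrict]
  have hG0 : G.det.eval 0 = l (.inl ()) (.inl ()) ψ := by
    rw [← Polynomial.coe_evalRingHom, RingHom.map_det]
    have : (Polynomial.evalRingHom 0).mapMatrix G = Matrix.fromBlocks
        (Matrix.of fun _ _ => l (.inl ()) (.inl ()) ψ)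
        (Matrix.of fun _ j => l (.inl ()) (.inr j) ψ) 0 1 := by
      ext (i | i) (j | j) <;> simp [G, D]
    rw [this, Matrix.det_fromBlocks_zero₂₁]
    simp
  rw [hG, Polynomial.derivative_mul] at h
  simpa [hG0] using h

theorem finrank_map_mkQ_add_finrank_inf {W : Type*} [AddCommGroup W] [Module k W]
    [FiniteDimensional k W] (S E : Submodule k W) :
    finrank k (S.map E.mkQ) + finrank k ↥(S ⊓ E) = finrank k S := by
  have h := LinearMap.finrank_range_add_finrank_ker (E.mkQ ∘ₗ S.subtype)
  rw [LinearMap.range_comp, range_subtype] at h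
  rw [← h, LinearMap.ker_comp, ker_mkQ, ← map_comap_subtype, finrank_map_subtype_eq]

/-- The tangent condition imposed by one Schubert condition. -/
theorem apply_mem_sup_of_mem_mTangent {W : Type*} [AddCommGroup W] [Module k W]
    [FiniteDimensional k W] {V C E : Submodule k W} {S : Set (Submodule k W)}
    (hS : ∀ V' ∈ S, finrank k V' = finrank k V ∧ finrank k ↥(V ⊓ E) ≤ finrank k ↥(V' ⊓ E))
    {ψ : V →ₗ[k] C} (hψ : ψ ∈ mTangent k {ψ : V →ₗ[k] C | graphMap V C ψ ∈ S} 0)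
    {v : V} (hv : (v : W) ∈ E) : (ψ v : W) ∈ V ⊔ E := by
  by_contra hn
  obtain ⟨μ₀, hμ₀, hμ₀k⟩ := exists_le_ker_of_notMem hn
  let B := finBasis k (V.map E.mkQ)
  choose g hgV hg using fun t => mem_map.1 (B t).2
  choose μ hμ using fun t => (B.coord t).exists_extend
  let f : Unit ⊕ Fin (finrank k (V.map E.mkQ)) → V := Sum.elim (fun _ => v) fun t => ⟨g t, hgV t⟩
  let lam : Unit ⊕ Fin (finrank k (V.map E.mkQ)) → Dual k W :=
    Sum.elim (fun _ => μ₀) fun t => μ t ∘ₗ E.mkQ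
  refine hμ₀ (apply_eq_zero_of_det_eq_zero hψ
    (fun i j => (lam i ∘ₗ C.subtype) ∘ₗ LinearMap.applyₗ (f j)) fun φ hφ => ?_)
  have hE : ∀ i, ∀ w ∈ E, lam i w = 0 := by
    rintro (i | i) w hw
    · exact hμ₀k (mem_sup_right hw)
    · simp [lam, (Quotient.mk_eq_zero E).2 hw]
  have hmat : Matrix.fromBlocks 0 0 0 1 + (Matrix.of fun i j =>
      ((lam i ∘ₗ C.subtype) ∘ₗ LinearMap.applyₗ (f j)) φ) =
      Matrix.of fun i j => lam i ((V.subtype + C.subtype ∘ₗ φ) (f j)) := by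
    ext i j
    simp only [Matrix.add_apply, Matrix.of_apply, LinearMap.add_apply, map_add]
    congr 1
    rcases i with i | i
    · rw [show lam (.inl i) (V.subtype (f j)) = 0 from hμ₀k (mem_sup_left (f j).2)]
      cases j <;> rfl
    · rcases j with j | j
      · exact (hE _ _ hv).symm
      · have h1 : lam (.inr i) (V.subtype (f (.inr j))) = μ i (B j) := by
          rw [← hg]
          rfl
        have h2 : μ i (B j) = B.coord i (B j) := LinearMap.congr_fun (hμ i) (B j)
        rw [h1, h2]
        simp [Matrix.one_apply, Finsupp.single_apply, eq_comm]
  rw [hmat, ← Matrix.exists_mulVec_eq_zero_iff]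
  have hle : finrank k ((graphMap V C φ).map E.mkQ) ≤ finrank k (V.map E.mkQ) := by
    have h1 := finrank_map_mkQ_add_finrank_inf (graphMap V C φ) E
    have h2 := finrank_map_mkQ_add_finrank_inf V E
    have h3 := hS _ hφ
    omega
  have hdep : ¬ LinearIndependent k fun j => (⟨E.mkQ ((V.subtype + C.subtype ∘ₗ φ) (f j)),
      mem_map_of_mem ⟨f j, rfl⟩⟩ : (graphMap V C φ).map E.mkQ) := fun h => by
    have := h.fintype_card_le_finrank
    simp only [Fintype.card_sum, Fintype.card_unit, Fintype.card_fin] at this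
    omega
  obtain ⟨c, hc, i, hi⟩ := Fintype.not_linearIndependent_iff.1 hdep
  refine ⟨c, fun h => hi (congrFun h i), ?_⟩
  have hcE : ∑ j, c j • (V.subtype + C.subtype ∘ₗ φ) (f j) ∈ E := by
    rw [← Quotient.mk_eq_zero E, ← mkQ_apply, map_sum]
    simpa [Subtype.ext_iff] using hc
  funext i
  have := hE i _ hcE
  rw [map_sum] at this
  rw [Matrix.mulVec, dotProduct, Pi.zero_apply, ← this]
  exact Finset.sum_congr rfl fun j _ => by rw [map_smul, smul_eq_mul, mul_comm]; rfl

end Tangent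

section Final

theorem PolyMap.exists_mEval {k M : Type*} [Field k] [AddCommGroup M] [Module k M] {f : M → k}
    (hf : PolyMap k f) : ∃ p : MvPolynomial (Dual k M) k, ∀ x, mEval k x p = f x := by
  refine Algebra.adjoin_induction (fun f hf => ?_) (fun c => ⟨MvPolynomial.C c, fun x => ?_⟩)
    (fun f g _ _ hf hg => ?_) (fun f g _ _ hf hg => ?_) (PolyMap.iff_mem.1 hf)
  · obtain ⟨l, rfl⟩ := hf
    exact ⟨MvPolynomial.X l, fun x => by simp [mEval]⟩
  · simp [mEval]
  · obtain ⟨p, hp⟩ := hf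
    obtain ⟨q, hq⟩ := hg
    exact ⟨p + q, fun x => by rw [mEval, map_add, ← mEval, ← mEval, hp, hq]; rfl⟩
  · obtain ⟨p, hp⟩ := hf
    obtain ⟨q, hq⟩ := hg
    exact ⟨p * q, fun x => by rw [mEval, map_mul, ← mEval, ← mEval, hp, hq]; rfl⟩

theorem genericFlags_of_eventually {k M : Type*} [Field k] [Infinite k] [AddCommGroup M] [Module k M]
    [FiniteDimensional k M] {s n : ℕ} (hn : n ≤ finrank k M)
    {P : (Fin s → ℕ → Submodule k M) → Prop}
    (h : ∀ᶠ b in zar k (Fin s → Fin n → M),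
      (∀ j, LinearIndependent k (b j)) → P fun j => spanFlag k (b j)) :
    GenericFlags k s n P := by
  obtain ⟨f, hf, ⟨x, hx⟩, hfP⟩ := eventually_zar.1 h
  obtain ⟨p, hp⟩ := hf.exists_mEval
  obtain ⟨b, hb, hb0⟩ := ((eventually_forall_linearIndependent (σ := Fin s) (ι := Fin n)
    (by simpa using hn)).and (hf.eventually_ne hx)).exists
  refine ⟨{b | mEval k b p ≠ 0}, TopologicalSpace.isOpen_generateFrom_of_mem ⟨p, rfl⟩,
    ⟨b, ?_, hb⟩, fun b hb => hfP b ?_⟩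
  · simpa [hp] using hb0
  · rw [← hp]
    exact hb

/-- A rigid subspace is an isolated reduced point of the intersection of the Schubert conditions. -/
theorem Rigid.iInf_grTangent_eq_bot {k W : Type*} [Field k] [AddCommGroup W] [Module k W]
    [FiniteDimensional k W] {n r s : ℕ} {I : Fin s → Fin r → Fin n} {b : Fin s → Fin n → W}
    {V C : Submodule k W} (hs : 0 < s) (hV : finrank k V = r) (h : Rigid I b V)
    (hdim : ∀ j a, finrank k ↥(V ⊓ spanFlag k (b j) (I j a + 1)) = a + 1) (hC : IsCompl V C) :
    ⨅ j, grTangent {V' | varMem (I j) (spanFlag k (b j)) V'} V C = ⊥ := by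
  have hinj : Function.Injective (conjMap V C) := by
    refine (injective_iff_map_eq_zero _).2 fun ψ hψ => LinearMap.ext fun v => ?_
    have h1 : V.mkQ (ψ v : W) = 0 := LinearMap.congr_fun hψ v
    rw [mkQ_apply, Quotient.mk_eq_zero] at h1
    exact Subtype.ext (disjoint_def.1 hC.disjoint _ h1 (ψ v).2)
  have hflag : ∀ (j : Fin s) (a : Fin r), spanFlag k (b j) (I j a + 1) =
      span k (b j '' Set.Iic (I j a)) := fun j a => by
    have : {c : Fin n | (c : ℕ) < I j a + 1} = Set.Iic (I j a) :=
      Set.ext fun c => Nat.lt_succ_iff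
    rw [spanFlag, this]
  refine (eq_bot_iff).2 fun φ hφ => ?_
  simp only [mem_iInf, grTangent, mem_map] at hφ
  obtain ⟨ψ, -, rfl⟩ := hφ ⟨0, hs⟩
  have hψ : ∀ j, ψ ∈ mTangent k
      {ψ : V →ₗ[k] C | graphMap V C ψ ∈ {V' | varMem (I j) (spanFlag k (b j)) V'}} 0 := fun j => by
    obtain ⟨ψ', hψ', he⟩ := hφ j
    rwa [← hinj he]
  have h0 := h (C.subtype ∘ₗ ψ) fun j a v hv => by
    rw [← hflag] at hv ⊢
    refine apply_mem_sup_of_mem_mTangent (fun V' hV' => ?_) (hψ j) hv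
    rw [hV, hdim]
    exact ⟨hV'.1, hV'.2 a⟩
  have : ψ = 0 := LinearMap.ext fun v =>
    Subtype.ext (disjoint_def.1 hC.disjoint _ (h0 v) (ψ v).2)
  rw [this, map_zero]
  exact zero_mem _

end Final

/-- Corollary `sottilee`.  If the expected dimension
`dim Gr(r,n) - ∑_j codim ω_{I^j}` is `0`, then for a generic `𝓔 ∈ Fl(W)^s` the
scheme-theoretic intersection `∩_j Ω_{I^j}(E^j_•)` is a reduced zero-dimensional scheme
(possibly empty): the set of its points is finite, and at each point the Zariski
tangent space of the intersection (the intersection of the tangent spaces to the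
Schubert varieties, computed in any chart) vanishes.  This holds over an algebraically
closed field of any characteristic. -/
theorem stmt18 (k : Type) [Field k] [IsAlgClosed k]
    {W : Type} [AddCommGroup W] [Module k W] [FiniteDimensional k W]
    (n r s : ℕ) (hs : 0 < s) (hW : Module.finrank k W = n)
    (I : Fin s → Fin r → Fin n) (hI : ∀ j, StrictMono (I j))
    (h0 : (r : ℤ) * ((n : ℤ) - (r : ℤ)) - ∑ j : Fin s, codimZ n r (I j) = 0) :
    GenericFlags k s n (fun E =>
      {V : Submodule k W | ∀ j, varMem (I j) (E j) V}.Finite ∧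
      ∀ V ∈ {V : Submodule k W | ∀ j, varMem (I j) (E j) V},
        ∀ C : Submodule k W, IsCompl V C →
          (⨅ j : Fin s, grTangent {V' : Submodule k W | varMem (I j) (E j) V'} V C)
            = ⊥) := by
  have hk : Infinite k := IsAlgClosed.instInfinite
  have hr : r ≤ n := by simpa using Fintype.card_le_of_injective _ (hI ⟨0, hs⟩).injective
  refine genericFlags_of_eventually hW.ge ((eventually_varMem hs hW hr hI h0).mono
    fun b hb hli => ⟨(hb hli).1, fun V hV C hC => ?_⟩)
  obtain ⟨hrigid, hdim⟩ := (hb hli).2 V hV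
  exact hrigid.iInf_grTangent_eq_bot hs (hV ⟨0, hs⟩).1 hdim hC


end
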